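/- arXiv:2512.22852 — 7 statements merged into one kernel-verified Lean document; each statement's English description precedes it below -/
import Mathlib

section
/- Let A ⊆ (ℕ → ℕ) × ℝ be an analytic set which is monotone, i.e., whenever x, x' ∈ ℕ → ℕ satisfy x(n) ≤ x'(n) for all n, the vertical section A_x = {y : (x,y) ∈ A} is contained in A_{x'}. If every vertical section A_x is countable, then the union ⋃_{x ∈ ℕ → ℕ} A_x is countable. -/
open Set Filter Topology TopologicalSpace CantorScheme PiNat
open scoped ENNReal

/-- If a set has uncountable image under a map out of a hereditarily Lindelöf space, then two of its
points with distinct images are condensation points for the image. -/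
theorem exists_condensation_pair {X Y : Type*} [TopologicalSpace X] [HereditarilyLindelofSpace X]
    {f : X → Y} {C : Set X} (hC : ¬ (f '' C).Countable) :
    ∃ x₀ x₁, f x₀ ≠ f x₁ ∧ (∀ U ∈ 𝓝 x₀, ¬ (f '' (U ∩ C)).Countable) ∧
      ∀ U ∈ 𝓝 x₁, ¬ (f '' (U ∩ C)).Countable := by
  set N : Set X := {x | ∃ U ∈ 𝓝 x, (f '' (U ∩ C)).Countable}
  have hN : (f '' (N ∩ C)).Countable := by
    refine (HereditarilyLindelofSpace.isLindelof N).induction_on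
      (p := fun t => (f '' (t ∩ C)).Countable) ?_ ?_ ?_
    · exact fun s t hst ht => ht.mono (by gcongr)
    · intro S hS hc
      simp only [sUnion_eq_biUnion, iUnion_inter, image_iUnion]
      exact hS.biUnion hc
    · rintro x ⟨U, hU, hc⟩
      exact ⟨U, mem_nhdsWithin_of_mem_nhds hU, hc⟩
  have hrest : ¬ (f '' (C \ N)).Countable := fun h => hC <| (h.union hN).mono <| by
    rw [← image_union, inter_comm, sdiff_union_inter]
  obtain ⟨_, ⟨x₀, h₀, rfl⟩, _, ⟨x₁, h₁, rfl⟩, hne⟩ :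
      (f '' (C \ N)).Nontrivial := by
    rw [← not_subsingleton_iff]
    exact fun h => hrest h.countable
  exact ⟨x₀, x₁, hne, fun U hU hc => h₀.2 ⟨U, hU, hc⟩, fun U hU hc => h₁.2 ⟨U, hU, hc⟩⟩

/-- A closed set with uncountable continuous image contains two small closed subsets with disjoint
uncountable images. -/
theorem exists_small_splitting_of_not_countable_image {X Y : Type*} [MetricSpace X]
    [SecondCountableTopology X] [TopologicalSpace Y] [T2Space Y] {f : X → Y} (hf : Continuous f)
    {C : Set X} (hclosed : IsClosed C) (hC : ¬ (f '' C).Countable) {ε : ℝ≥0∞} (hε : 0 < ε) :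
    ∃ D : Bool → Set X, (∀ b, IsClosed (D b) ∧ ¬ (f '' D b).Countable) ∧
      (∀ b, D b ⊆ C ∧ Metric.ediam (D b) ≤ ε) ∧ Disjoint (f '' D false) (f '' D true) := by
  obtain ⟨x₀, x₁, hne, h₀, h₁⟩ := exists_condensation_pair hC
  obtain ⟨V₀, V₁, hV₀, hV₁, hdisj⟩ := t2_separation_nhds hne
  have key : ∀ x, (∀ U ∈ 𝓝 x, ¬ (f '' (U ∩ C)).Countable) → ∀ V ∈ 𝓝 (f x),
      ∃ D : Set X, (IsClosed D ∧ ¬ (f '' D).Countable) ∧ (D ⊆ C ∧ Metric.ediam D ≤ ε) ∧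
        f '' D ⊆ V := by
    intro x hx V hV
    have hW : f ⁻¹' V ∩ Metric.eball x (ε / 2) ∈ 𝓝 x :=
      inter_mem (hf.continuousAt hV)
        (Metric.eball_mem_nhds x (ENNReal.div_pos hε.ne' ENNReal.ofNat_ne_top))
    obtain ⟨U, hU, hUclosed, hUW⟩ := exists_mem_nhds_isClosed_subset hW
    refine ⟨U ∩ C, ⟨hUclosed.inter hclosed, hx U hU⟩, ⟨inter_subset_right, ?_⟩, ?_⟩
    · calc
        _ ≤ Metric.ediam (Metric.eball x (ε / 2)) :=
          Metric.ediam_mono (inter_subset_left.trans (hUW.trans inter_subset_right))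
        _ ≤ 2 * (ε / 2) := Metric.ediam_eball_le
        _ = ε := ENNReal.mul_div_cancel two_ne_zero ENNReal.ofNat_ne_top
    · rw [image_subset_iff]
      exact inter_subset_left.trans (hUW.trans inter_subset_left)
  obtain ⟨D₀, hD₀, hs₀, hDV₀⟩ := key x₀ h₀ V₀ hV₀
  obtain ⟨D₁, hD₁, hs₁, hDV₁⟩ := key x₁ h₁ V₁ hV₁
  exact ⟨fun b => cond b D₁ D₀, Bool.forall_bool.2 ⟨hD₀, hD₁⟩, Bool.forall_bool.2 ⟨hs₀, hs₁⟩,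
    hdisj.mono hDV₀ hDV₁⟩

/-- A continuous map on a Polish space with uncountable range is injective on a copy of the Cantor
space. -/
theorem Continuous.exists_nat_bool_injective_comp {X Y : Type*} [TopologicalSpace X]
    [PolishSpace X] [TopologicalSpace Y] [T2Space Y] {f : X → Y} (hf : Continuous f)
    (hunc : ¬ (range f).Countable) :
    ∃ g : (ℕ → Bool) → X, Continuous g ∧ Function.Injective (f ∘ g) := by
  let := upgradeIsCompletelyMetrizable X
  obtain ⟨u, -, hupos, hu⟩ := exists_seq_strictAnti_tendsto' (zero_lt_one' ℝ≥0∞)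
  let P := {C : Set X // IsClosed C ∧ ¬ (f '' C).Countable}
  choose S hS hsmall hdisj using fun (C : P) (n : ℕ) =>
    exists_small_splitting_of_not_countable_image hf C.2.1 C.2.2 (hupos n).1
  let E : List Bool → P := fun l =>
    l.rec ⟨univ, isClosed_univ, by rwa [image_univ]⟩
      fun a l C => ⟨S C l.length a, hS C l.length a⟩
  let D : List Bool → Set X := fun l => (E l).1
  have hanti : ClosureAntitone D :=
    Antitone.closureAntitone (fun l a => (hsmall (E l) l.length a).1) fun l => (E l).2.1
  have hdiam : VanishingDiam D := by
    intro x
    rw [← tendsto_add_atTop_iff_nat 1]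
    refine tendsto_of_tendsto_of_tendsto_of_le_of_le tendsto_const_nhds hu
      (fun _ => zero_le) fun n => ?_
    exact (hsmall (E (res x n)) (res x n).length (x n)).2.trans_eq (congrArg u (res_length x n))
  have hnonempty : ∀ l, (D l).Nonempty := by
    intro l
    by_contra h
    apply (E l).2.2
    change (f '' D l).Countable
    simp [not_nonempty_iff_eq_empty.1 h]
  have hdom : ∀ x, x ∈ (inducedMap D).1 := by
    simp [hanti.map_of_vanishingDiam hdiam hnonempty]
  refine ⟨fun x => (inducedMap D).2 ⟨x, hdom x⟩, hdiam.map_continuous.comp (by fun_prop), ?_⟩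
  have hdisj' : ∀ l a b, a ≠ b → Disjoint (f '' D (a :: l)) (f '' D (b :: l)) := by
    rintro l (a | a) (b | b) hab <;> try contradiction
    · exact hdisj _ _
    · exact (hdisj _ _).symm
  intro x y hxy
  apply res_injective
  ext n : 1
  induction n with
  | zero => simp
  | succ n ih =>
    simp only [res_succ, List.cons.injEq]
    refine ⟨?_, ih⟩
    by_contra hne
    refine disjoint_left.1 (hdisj' (res x n) _ _ hne)
      (mem_image_of_mem f (map_mem ⟨x, hdom x⟩ (n + 1))) ?_
    rw [ih]
    exact ⟨_, map_mem ⟨y, hdom y⟩ (n + 1), hxy.symm⟩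

/-- **GP(Σ¹₁, ctble)**: if `A ⊆ (ℕ → ℕ) × ℝ` is analytic and monotone with all vertical
sections countable, then the union of the vertical sections is countable. -/
theorem gp_analytic_countable (A : Set ((ℕ → ℕ) × ℝ))
    (hA : MeasureTheory.AnalyticSet A)
    (hmono : ∀ x x' : ℕ → ℕ, (∀ n, x n ≤ x' n) →
      {y : ℝ | (x, y) ∈ A} ⊆ {y : ℝ | (x', y) ∈ A})
    (hctble : ∀ x : ℕ → ℕ, ({y : ℝ | (x, y) ∈ A}).Countable) :
    (⋃ x : ℕ → ℕ, {y : ℝ | (x, y) ∈ A}).Countable := by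
  rw [MeasureTheory.AnalyticSet] at hA
  obtain rfl | ⟨f, hf, rfl⟩ := hA
  · simp
  have hunion : (⋃ x, {y : ℝ | (x, y) ∈ range f}) = range (Prod.snd ∘ f) := by
    ext y
    simp [Prod.ext_iff]
  rw [hunion]
  by_contra hunc
  obtain ⟨g, hg, hinj⟩ := (continuous_snd.comp hf).exists_nat_bool_injective_comp hunc
  have hbdd : ∀ n, ∃ b, ∀ t, (f (g t)).1 n ≤ b := fun n => by
    obtain ⟨b, hb⟩ := (isCompact_range (f := fun t => (f (g t)).1 n) (by fun_prop)).bddAbove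
    exact ⟨b, fun t => hb ⟨t, rfl⟩⟩
  choose b hb using hbdd
  have hrange : (range ((Prod.snd ∘ f) ∘ g)).Countable := (hctble b).mono <| by
    rintro _ ⟨t, rfl⟩
    exact hmono (f (g t)).1 b (fun n => hb n t) ⟨g t, rfl⟩
  have huncountable : ¬ Countable (ℕ → Bool) := by
    rw [← Cardinal.mk_le_aleph0_iff]
    simp [Cardinal.aleph0_lt_continuum]
  exact huncountable <| countable_univ_iff.1 <|
    countable_of_injective_of_countable_image hinj.injOn <| by rwa [image_univ]
end

section
/- The following are equivalent: (1) for every family (A_x)_{x ∈ ℕ → ℕ} of countable subsets of ℝ which is monotone (x ≤ x' pointwise implies A_x ⊆ A_{x'}), the union ⋃_{x ∈ ℕ → ℕ} A_x is countable; (2) every family F ⊆ ℕ → ℕ of cardinality ℵ₁ is bounded, i.e., there exists g ∈ ℕ → ℕ such that every f ∈ F satisfies f(n) ≤ g(n) for all but finitely many n. -/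
open Cardinal Filter

/-- A function eventually dominated by `g` is dominated everywhere by some `g + m`. -/
theorem exists_le_add_const_of_eventually_le {x g : ℕ → ℕ} (h : ∀ᶠ n in atTop, x n ≤ g n) :
    ∃ m : ℕ, ∀ n, x n ≤ g n + m := by
  obtain ⟨N, hN⟩ := eventually_atTop.1 h
  refine ⟨∑ k ∈ Finset.range N, x k, fun n => ?_⟩
  rcases le_or_gt N n with hn | hn
  · exact (hN n hn).trans (Nat.le_add_right _ _)
  · exact (Finset.single_le_sum (f := x) (fun _ _ => Nat.zero_le _)
      (Finset.mem_range.2 hn)).trans (Nat.le_add_left _ _)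

/-- Countable families in `ℕ → ℕ` are bounded under eventual domination. -/
theorem Set.Countable.exists_eventually_le {S : Set (ℕ → ℕ)} (hS : S.Countable) :
    ∃ g : ℕ → ℕ, ∀ f ∈ S, ∀ᶠ n in atTop, f n ≤ g n := by
  rcases S.eq_empty_or_nonempty with rfl | hne
  · exact ⟨0, by simp⟩
  obtain ⟨e, rfl⟩ := hS.exists_eq_range hne
  refine ⟨fun n => ∑ i ∈ Finset.range (n + 1), e i n, ?_⟩
  rintro _ ⟨i, rfl⟩
  filter_upwards [eventually_ge_atTop i] with n hn
  exact Finset.single_le_sum (f := fun i => e i n) (fun _ _ => Nat.zero_le _)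
    (Finset.mem_range.2 (Nat.lt_succ_of_le hn))

/-- If families of cardinality `ℵ₁` are bounded, so are families of cardinality at most `ℵ₁`. -/
theorem exists_eventually_le_of_mk_le_aleph_one
    (h : ∀ F : Set (ℕ → ℕ), #F = ℵ₁ → ∃ g : ℕ → ℕ, ∀ f ∈ F, ∀ᶠ n in atTop, f n ≤ g n)
    {F : Set (ℕ → ℕ)} (hF : #F ≤ ℵ₁) :
    ∃ g : ℕ → ℕ, ∀ f ∈ F, ∀ᶠ n in atTop, f n ≤ g n := by
  have hc : ℵ₁ ≤ #(ℕ → ℕ) := by simpa using aleph_one_le_continuum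
  obtain ⟨G, hG⟩ := le_mk_iff_exists_set.1 hc
  obtain ⟨g, hg⟩ := h (F ∪ G) <| le_antisymm
    ((mk_union_le F G).trans (add_le_of_le (aleph0_le_aleph 1) hF hG.le))
    (hG.ge.trans (mk_le_mk_of_subset Set.subset_union_right))
  exact ⟨g, fun f hf => hg f (Or.inl hf)⟩

/-- **GP(all, ctble) is equivalent to 𝔟 > ℵ₁**: every monotone family of countable
subsets of `ℝ` indexed by Baire space has countable union iff every family of reals
in `ℕ → ℕ` of cardinality `ℵ₁` is bounded under eventual domination. -/
theorem gp_all_ctble_iff_b_gt_aleph_one :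
    (∀ A : (ℕ → ℕ) → Set ℝ,
        (∀ x, (A x).Countable) →
        (∀ x x' : ℕ → ℕ, (∀ n, x n ≤ x' n) → A x ⊆ A x') →
        (⋃ x : ℕ → ℕ, A x).Countable) ↔
    (∀ F : Set (ℕ → ℕ), Cardinal.mk F = Cardinal.aleph 1 →
        ∃ g : ℕ → ℕ, ∀ f ∈ F, ∀ᶠ n in Filter.atTop, f n ≤ g n) := by
  constructor
  · intro h F hF
    by_contra! hunb
    obtain ⟨r, _, hr⟩ := exists_ord_eq F
    have hseg (a : F) : {b | r b a}.Countable := by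
      rw [← le_aleph0_iff_set_countable, ← lt_aleph_one_iff, ← hF]
      exact card_typein_lt (r := r) a hr
    obtain ⟨φ⟩ : Nonempty (F ↪ ℝ) := by
      rw [← Cardinal.le_def, hF, mk_real]
      exact aleph_one_le_continuum
    let A : (ℕ → ℕ) → Set ℝ := fun x =>
      φ '' {a | ∀ b : F, ¬ r a b → ∀ᶠ n in atTop, b.1 n ≤ x n}
    have hA : (⋃ x, A x).Countable := by
      refine h A (fun x => ?_) fun x x' hxx' => Set.image_mono fun a ha b hb => ?_
      · obtain ⟨f, hf, hfx⟩ := hunb x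
        refine ((hseg ⟨f, hf⟩).mono fun a ha => ?_).image φ
        by_contra hra
        obtain ⟨n, hn, hn'⟩ := (hfx.and_eventually (ha ⟨f, hf⟩ hra)).exists
        exact absurd hn' (not_le.2 hn)
      · exact (ha b hb).mono fun n hn => hn.trans (hxx' n)
    have hrange : Set.range φ ⊆ ⋃ x, A x := by
      rintro _ ⟨a, rfl⟩
      have hle : {b | ¬ r a b}.Countable := by
        refine ((hseg a).insert a).mono fun b hb => ?_
        rcases trichotomous_of r a b with hab | rfl | hba
        · exact absurd hab hb
        · exact Set.mem_insert _ _
        · exact Or.inr hba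
      obtain ⟨g, hg⟩ := (hle.image Subtype.val).exists_eventually_le
      exact Set.mem_iUnion.2 ⟨g, a, fun b hb => hg b ⟨b, hb, rfl⟩, rfl⟩
    have hcount := le_aleph0_iff_set_countable.2 (hA.mono hrange)
    rw [mk_range_eq φ φ.injective, hF] at hcount
    exact absurd hcount (not_le.2 aleph0_lt_aleph_one)
  · intro h A hA hmono
    by_contra hunc
    have hcard : ℵ₁ ≤ #(⋃ x, A x) := by
      rwa [← not_lt, lt_aleph_one_iff, le_aleph0_iff_set_countable]
    obtain ⟨B, hBsub, hB⟩ := le_mk_iff_exists_subset.1 hcard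
    choose x hx using fun b : B => Set.mem_iUnion.1 (hBsub b.2)
    obtain ⟨g, hg⟩ := exists_eventually_le_of_mk_le_aleph_one h (mk_range_le.trans hB.le)
    have hBc : B.Countable := by
      refine (Set.countable_iUnion fun m : ℕ => hA fun n => g n + m).mono fun b hb => ?_
      obtain ⟨m, hm⟩ := exists_le_add_const_of_eventually_le (hg (x ⟨b, hb⟩) ⟨_, rfl⟩)
      exact Set.mem_iUnion.2 ⟨m, hmono _ _ hm (hx ⟨b, hb⟩)⟩
    rw [← le_aleph0_iff_set_countable, hB] at hBc
    exact absurd hBc (not_le.2 aleph0_lt_aleph_one)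
end

section
/- Let X be a compact metric space and let f : [0,∞) → [0,∞) be a gauge function (f(0) = 0, f nondecreasing) which is continuous and doubling, meaning there is r > 0 such that f(2t) < r·f(t) for every t > 0. Let A ⊆ (ℕ → ℕ) × X be an analytic set which is monotone (x ≤ x' pointwise implies A_x ⊆ A_{x'}), and suppose that every vertical section A_x has f-Hausdorff measure zero. Then ⋃_{x ∈ ℕ → ℕ} A_x has f-Hausdorff measure zero. -/
open MeasureTheory
open scoped ENNReal

section HausdorffContent

open Set Filter Topology Metric TopologicalSpace

/-- An extended gauge function: `g 0 = 0`, and at finite arguments `g` is finite, monotone,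
continuous, and positive away from `0`. Nothing is required of `g ∞`. -/
structure IsGauge (g : ℝ≥0∞ → ℝ≥0∞) : Prop where
  zero : g 0 = 0
  ne_top : ∀ d, d ≠ ∞ → g d ≠ ∞
  mono : ∀ a b, b ≠ ∞ → a ≤ b → g a ≤ g b
  continuousAt : ∀ d, d ≠ ∞ → ContinuousAt g d
  pos : ∀ d, d ≠ ∞ → 0 < d → 0 < g d

/-- A positive sequence with finite sum can be injectively reindexed so that the term placed in
position `k` is at most the sum divided by `k`: send `i` to its rank in decreasing order. -/
theorem ENNReal.exists_injective_mul_le_tsum {b : ℕ → ℝ≥0∞} (hpos : ∀ i, b i ≠ 0)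
    (hsum : ∑' i, b i ≠ ∞) :
    ∃ e : ℕ → ℕ, Function.Injective e ∧ ∀ i, (e i : ℝ≥0∞) * b i ≤ ∑' j, b j := by
  have hfin (i : ℕ) : {j | b i ≤ b j}.Finite :=
    ENNReal.finite_const_le_of_tsum_ne_top hsum (hpos i)
  let S (i : ℕ) : Set ℕ := {j | b i < b j ∨ (b j = b i ∧ j < i)}
  have hS (i : ℕ) : S i ⊆ {j | b i ≤ b j} := by
    rintro j (h | h)
    · exact h.le
    · exact h.1.ge
  have hSfin (i : ℕ) : (S i).Finite := (hfin i).subset (hS i)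
  have hlt {i j : ℕ} (h : j ∈ S i) : (S j).ncard < (S i).ncard := by
    refine Set.ncard_lt_ncard ⟨fun k hk => ?_, fun hsub => ?_⟩ (hSfin i)
    · rcases h with h | h <;> rcases hk with hk | hk
      · exact Or.inl (h.trans hk)
      · exact Or.inl (hk.1 ▸ h)
      · exact Or.inl (h.1 ▸ hk)
      · exact Or.inr ⟨hk.1.trans h.1, hk.2.trans h.2⟩
    · rcases hsub h with h | h
      · exact lt_irrefl _ h
      · exact lt_irrefl _ h.2
  refine ⟨fun i => (S i).ncard, fun i j hij => ?_, fun i => ?_⟩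
  · by_contra hne
    have : j ∈ S i ∨ i ∈ S j := by
      rcases lt_trichotomy (b i) (b j) with h | h | h
      · exact Or.inl (Or.inl h)
      · rcases lt_or_gt_of_ne hne with h' | h'
        · exact Or.inr (Or.inr ⟨h, h'⟩)
        · exact Or.inl (Or.inr ⟨h.symm, h'⟩)
      · exact Or.inr (Or.inl h)
    rcases this with h | h
    · exact (hlt h).ne hij.symm
    · exact (hlt h).ne hij
  · calc ((S i).ncard : ℝ≥0∞) * b i = ∑ j ∈ (hSfin i).toFinset, b i := by
          rw [Finset.sum_const, nsmul_eq_mul, Set.ncard_eq_toFinset_card _ (hSfin i)]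
      _ ≤ ∑ j ∈ (hSfin i).toFinset, b j :=
          Finset.sum_le_sum fun j hj => hS i ((hSfin i).mem_toFinset.1 hj)
      _ ≤ ∑' j, b j := ENNReal.sum_le_tsum _

/-- The Hausdorff content of gauge `g`: the infimum of `∑ g (diam Cₙ)` over all countable covers,
with no restriction on the diameters. -/
noncomputable def hausdorffContent (X : Type*) [PseudoEMetricSpace X] {g : ℝ≥0∞ → ℝ≥0∞}
    (hg : g 0 = 0) : OuterMeasure X :=
  OuterMeasure.ofFunction (fun s => g (ediam s)) (by simpa using hg)

section Content

variable {X : Type*} {g : ℝ≥0∞ → ℝ≥0∞}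

theorem hausdorffContent_le [PseudoEMetricSpace X] (hg : g 0 = 0) (s : Set X) :
    hausdorffContent X hg s ≤ g (ediam s) :=
  OuterMeasure.ofFunction_le s

theorem exists_cover_of_hausdorffContent_lt [PseudoEMetricSpace X] (hg : g 0 = 0) {s : Set X}
    {a : ℝ≥0∞} (h : hausdorffContent X hg s < a) :
    ∃ t : ℕ → Set X, s ⊆ ⋃ i, t i ∧ ∑' i, g (ediam (t i)) < a := by
  rw [hausdorffContent, OuterMeasure.ofFunction_apply] at h
  simpa only [iInf_lt_iff, exists_prop] using h

theorem hausdorffContent_le_mkMetric [EMetricSpace X] (hg : g 0 = 0) :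
    hausdorffContent X hg ≤ OuterMeasure.mkMetric g :=
  OuterMeasure.le_mkMetric g _ 1 one_pos fun s _ => hausdorffContent_le hg s

/-- Covers witnessing a bound on the content can be taken by closed sets, listed so that the
diameters tend to zero at a rate depending only on the bound. -/
theorem exists_closeds_cover_of_hausdorffContent_lt [PseudoEMetricSpace X] (hg : g 0 = 0) {s : Set X} {a : ℝ≥0∞}
    (h : hausdorffContent X hg s < a) :
    ∃ T : ℕ → Closeds X, s ⊆ ⋃ i, (T i : Set X) ∧ ∑' i, g (ediam (T i : Set X)) < a ∧
      ∀ i : ℕ, i * g (ediam (T i : Set X)) ≤ a := by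
  obtain ⟨t, hst, ht⟩ := exists_cover_of_hausdorffContent_lt hg h
  obtain ⟨ε, hε, hεsum⟩ := ENNReal.exists_pos_sum_of_countable' (tsub_pos_iff_lt.2 ht).ne' ℕ
  have hsum : ∑' i, (g (ediam (t i)) + ε i) < a := by
    rw [ENNReal.tsum_add, add_comm]
    exact lt_tsub_iff_right.1 hεsum
  obtain ⟨e, he, hle⟩ := ENNReal.exists_injective_mul_le_tsum
    (b := fun i => g (ediam (t i)) + ε i) (fun i => (by simp [(hε i).ne'])) hsum.ne_top
  let T : ℕ → Closeds X := Function.extend e (fun i => Closeds.closure (t i)) fun _ => ⊥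
  have hT (i : ℕ) : T (e i) = Closeds.closure (t i) := he.extend_apply _ _ i
  have hT' (k : ℕ) (hk : ¬∃ i, e i = k) : T k = ⊥ := Function.extend_apply' _ _ _ hk
  have hext : (fun k => g (ediam (T k : Set X))) =
      Function.extend e (fun i => g (ediam (t i))) 0 := by
    ext k
    by_cases hk : ∃ i, e i = k
    · obtain ⟨i, rfl⟩ := hk
      simp [hT, he.extend_apply]
    · simp [hT' k hk, Function.extend_apply' _ _ _ hk, hg]
  refine ⟨T, hst.trans (iUnion_subset fun i => ?_), ?_, fun k => ?_⟩
  · refine Subset.trans ?_ (subset_iUnion _ (e i))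
    rw [hT]
    exact subset_closure
  · rwa [hext, tsum_extend_zero he]
  · by_cases hk : ∃ i, e i = k
    · obtain ⟨i, rfl⟩ := hk
      have : ediam (T (e i) : Set X) = ediam (t i) := by simp [hT]
      rw [this]
      exact (mul_le_mul_right (le_self_add) _).trans ((hle i).trans hsum.le)
    · simp [hT' k hk, hg]

variable [MetricSpace X] [CompactSpace X]

theorem ediam_ne_top_of_compactSpace (s : Set X) : ediam s ≠ ∞ :=
  (Bornology.IsBounded.all s).ediam_ne_top

/-- A set of content zero has measure zero: a cover of small sum consists of small sets. -/
theorem mkMetric_eq_zero_of_hausdorffContent_eq_zero (hg : IsGauge g) {s : Set X}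
    (h : hausdorffContent X hg.zero s = 0) : OuterMeasure.mkMetric g s = 0 := by
  simp only [OuterMeasure.mkMetric, OuterMeasure.mkMetric', OuterMeasure.iSup_apply,
    ENNReal.iSup_eq_zero]
  intro r hr
  refine le_antisymm (le_of_forall_gt_imp_ge_of_dense fun ε hε => ?_) zero_le
  obtain ⟨d, hd0, hdr⟩ := exists_between hr
  have hd : d ≠ ∞ := hdr.ne_top
  obtain ⟨t, hst, ht⟩ := exists_cover_of_hausdorffContent_lt hg.zero
    (h.trans_lt (lt_min hε (hg.pos d hd hd0)))
  have hdiam (i : ℕ) : ediam (t i) ≤ r := by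
    by_contra! hi
    exact (((ENNReal.le_tsum i).trans_lt ht).trans_le (min_le_right _ _)).not_ge
      (hg.mono _ _ (ediam_ne_top_of_compactSpace _) (hdr.trans hi).le)
  calc _ ≤ ∑' i, OuterMeasure.mkMetric'.pre (fun s => g (ediam s)) r (t i) :=
        (measure_mono hst).trans (measure_iUnion_le _)
    _ ≤ ∑' i, g (ediam (t i)) :=
        ENNReal.tsum_le_tsum fun i => OuterMeasure.mkMetric'.pre_le (hdiam i)
    _ ≤ ε := ht.le.trans (min_le_left _ _)

theorem IsGauge.exists_thickening_le (hg : IsGauge g) (s : Set X) {ε : ℝ≥0∞} (hε : ε ≠ 0) :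
    ∃ δ : ℝ, 0 < δ ∧ g (ediam (thickening δ s)) ≤ g (ediam s) + ε := by
  have hs := ediam_ne_top_of_compactSpace s
  have hlim : Tendsto (fun δ : NNReal => g (ediam s + 2 * δ)) (𝓝 0) (𝓝 (g (ediam s))) := by
    refine (hg.continuousAt _ hs).tendsto.comp ?_
    have : Continuous fun δ : NNReal => ediam s + 2 * (δ : ℝ≥0∞) :=
      continuous_const.add ((ENNReal.continuous_const_mul (by simp)).comp ENNReal.continuous_coe)
    simpa using this.tendsto 0
  have hev := (hlim.mono_left (nhdsWithin_le_nhds (s := Ioi 0))).eventually_lt_const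
    (ENNReal.lt_add_right (hg.ne_top _ hs) hε)
  obtain ⟨δ, hδ, hδ0⟩ := (hev.and self_mem_nhdsWithin).exists
  exact ⟨δ, hδ0, (hg.mono _ _ (by finiteness) (ediam_thickening_le δ)).trans hδ.le⟩

theorem IsGauge.continuous_ediam (hg : IsGauge g) :
    Continuous fun C : Closeds X => g (ediam (C : Set X)) := by
  refine continuous_iff_continuousAt.2 fun C => ?_
  have hle (A B : Closeds X) : ediam (A : Set X) ≤ ediam (B : Set X) + 2 * edist A B := by
    refine ediam_le fun x hx y hy => ?_
    refine ENNReal.le_of_forall_pos_le_add fun δ hδ hfin => ?_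
    have hAB : hausdorffEDist (A : Set X) B < edist A B + (δ / 2 : NNReal) := by
      rw [Closeds.edist_eq]
      refine ENNReal.lt_add_right (fun h => ?_) (by simpa using hδ.ne')
      simp [Closeds.edist_eq, h] at hfin
    obtain ⟨x', hx', hxx'⟩ := exists_edist_lt_of_hausdorffEDist_lt hx hAB
    obtain ⟨y', hy', hyy'⟩ := exists_edist_lt_of_hausdorffEDist_lt hy hAB
    calc edist x y ≤ edist x x' + edist x' y' + edist y' y := edist_triangle4 _ _ _ _
      _ ≤ (edist A B + (δ / 2 : NNReal)) + ediam (B : Set X)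
          + (edist A B + (δ / 2 : NNReal)) := by
        gcongr
        · exact edist_le_ediam_of_mem hx' hy'
        · rw [edist_comm]; exact hyy'.le
      _ = ediam (B : Set X) + 2 * edist A B + ((δ / 2 : NNReal) + (δ / 2 : NNReal)) := by ring
      _ = ediam (B : Set X) + 2 * edist A B + δ := by rw [← ENNReal.coe_add, add_halves]
  have hC : Tendsto (fun A : Closeds X => ediam (A : Set X)) (𝓝 C) (𝓝 (ediam (C : Set X))) :=
    (continuous_of_le_add_edist 2 (by simp) hle).tendsto C
  exact (hg.continuousAt _ (ediam_ne_top_of_compactSpace _)).tendsto.comp hC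

/-- The content is outer regular. -/
theorem exists_isOpen_hausdorffContent_lt (hg : IsGauge g) {s : Set X} {a : ℝ≥0∞}
    (h : hausdorffContent X hg.zero s < a) :
    ∃ U, IsOpen U ∧ s ⊆ U ∧ hausdorffContent X hg.zero U < a := by
  obtain ⟨t, hst, ht⟩ := exists_cover_of_hausdorffContent_lt hg.zero h
  obtain ⟨ε, hε, hεsum⟩ := ENNReal.exists_pos_sum_of_countable' (tsub_pos_iff_lt.2 ht).ne' ℕ
  choose δ hδ hle using fun i => hg.exists_thickening_le (t i) (hε i).ne'
  refine ⟨⋃ i, thickening (δ i) (t i), isOpen_iUnion fun i => isOpen_thickening,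
    hst.trans (iUnion_mono fun i => self_subset_thickening (hδ i) _), ?_⟩
  calc _ ≤ ∑' i, hausdorffContent X hg.zero (thickening (δ i) (t i)) := measure_iUnion_le _
    _ ≤ ∑' i, (g (ediam (t i)) + ε i) :=
        ENNReal.tsum_le_tsum fun i => (hausdorffContent_le _ _).trans (hle i)
    _ = ∑' i, g (ediam (t i)) + ∑' i, ε i := ENNReal.tsum_add
    _ < a := by
        rw [add_comm]
        exact lt_tsub_iff_right.1 hεsum

/-- **Increasing sets lemma** for the Hausdorff content. Extract a limit of near-optimal closed
covers of the `E n`; what the limit sets miss is covered by arbitrarily small sets, so its size is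
controlled by the Hausdorff measure, which is continuous along increasing sequences. -/
theorem hausdorffContent_iUnion_le (hg : IsGauge g) {E : ℕ → Set X} (hE : Monotone E)
    {s : ℝ≥0∞} (hs : ∀ n, hausdorffContent X hg.zero (E n) ≤ s) :
    hausdorffContent X hg.zero (⋃ n, E n) ≤ s := by
  borelize X
  rcases eq_or_ne s ∞ with rfl | hs_top
  · exact le_top
  refine ENNReal.le_of_forall_pos_le_add fun ε hε _ => ?_
  have hlt (n : ℕ) : hausdorffContent X hg.zero (E n) < s + ((n : ℝ≥0∞) + 1)⁻¹ :=
    (hs n).trans_lt (ENNReal.lt_add_right hs_top (by simp))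
  choose T hTcov hTsum hTrate using
    fun n => exists_closeds_cover_of_hausdorffContent_lt hg.zero (hlt n)
  obtain ⟨C, ψ, hψ, hC⟩ := CompactSpace.tendsto_subseq T
  rw [tendsto_pi_nhds] at hC
  let c (i : ℕ) : ℝ≥0∞ := g (ediam (C i : Set X))
  have hc (i : ℕ) : Tendsto (fun m => g (ediam (T (ψ m) i : Set X))) atTop (𝓝 (c i)) :=
    (hg.continuous_ediam.tendsto (C i)).comp (hC i)
  obtain ⟨η, hη, hηsum⟩ :=
    ENNReal.exists_pos_sum_of_countable' (ENNReal.coe_pos.2 hε).ne' ℕ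
  choose δ hδ hle using fun i => hg.exists_thickening_le (C i : Set X) (hη i).ne'
  set U : Set X := ⋃ i, thickening (δ i) (C i : Set X) with hU
  have hTU (i : ℕ) : ∀ᶠ m in atTop, (T (ψ m) i : Set X) ⊆ U := by
    have := (hC i).eventually (Metric.eball_mem_nhds _ (ENNReal.ofReal_pos.2 (hδ i)))
    filter_upwards [this] with m hm x hx
    obtain ⟨y, hy, hxy⟩ := exists_edist_lt_of_hausdorffEDist_lt hx hm
    exact mem_iUnion.2 ⟨i, (mem_thickening_iff_exists_edist_lt _ _).2 ⟨y, hy, hxy⟩⟩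
  have hlim : Tendsto (fun m => s + ((ψ m : ℝ≥0∞) + 1)⁻¹) atTop (𝓝 s) := by
    have h1 : Tendsto (fun m : ℕ => ((m : ℝ≥0∞) + 1)⁻¹) atTop (𝓝 0) := by
      have := (tendsto_add_atTop_iff_nat 1).2 ENNReal.tendsto_inv_nat_nhds_zero
      simpa using this
    simpa using tendsto_const_nhds.add (h1.comp hψ.tendsto_atTop)
  have hpre (n : ℕ) (r : ℝ≥0∞) (hr : 0 < r) :
      OuterMeasure.mkMetric'.pre (fun s => g (ediam s)) r (E n \ U) + ∑' i, c i ≤ s := by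
    rw [ENNReal.tsum_eq_iSup_nat, ENNReal.add_iSup]
    refine iSup_le fun k₀ => ?_
    obtain ⟨d, hd0, hdr⟩ := exists_between hr
    have hgd := hg.pos d hdr.ne_top hd0
    obtain ⟨k₁, hk₁⟩ := ENNReal.exists_nat_mul_gt hgd.ne' (b := s + 1) (by finiteness)
    let k := max k₀ k₁
    have hsmall (n i : ℕ) (hi : k ≤ i) : ediam (T n i : Set X) ≤ r := by
      by_contra! h
      refine hk₁.not_ge ?_
      calc (k₁ : ℝ≥0∞) * g d ≤ i * g (ediam (T n i : Set X)) := by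
            gcongr
            · exact (le_max_right _ _).trans hi
            · exact hg.mono _ _ (ediam_ne_top_of_compactSpace _) (hdr.trans h).le
        _ ≤ s + ((n : ℝ≥0∞) + 1)⁻¹ := hTrate n i
        _ ≤ s + 1 := by
            gcongr
            exact ENNReal.inv_le_one.2 (by simp)
    have hev : ∀ᶠ m in atTop, OuterMeasure.mkMetric'.pre (fun s => g (ediam s)) r (E n \ U) +
        ∑ i ∈ Finset.range k, g (ediam (T (ψ m) i : Set X)) ≤ s + ((ψ m : ℝ≥0∞) + 1)⁻¹ := by
      have hall : ∀ᶠ m in atTop, ∀ i ∈ Finset.range k, (T (ψ m) i : Set X) ⊆ U :=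
        (Finset.eventually_all _).2 fun i _ => hTU i
      filter_upwards [hall, hψ.tendsto_atTop.eventually_ge_atTop n] with m hm hnm
      have hcov : E n \ U ⊆ ⋃ i, (T (ψ m) (i + k) : Set X) := by
        rintro x ⟨hxE, hxU⟩
        obtain ⟨i, hi⟩ := mem_iUnion.1 (hTcov (ψ m) (hE hnm hxE))
        have hki : k ≤ i := by
          by_contra! hik
          exact hxU (hm i (Finset.mem_range.2 hik) hi)
        exact mem_iUnion.2 ⟨i - k, by rwa [Nat.sub_add_cancel hki]⟩
      calc _ ≤ ∑' i, g (ediam (T (ψ m) (i + k) : Set X)) +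
            ∑ i ∈ Finset.range k, g (ediam (T (ψ m) i : Set X)) := by
            gcongr
            refine (measure_mono hcov).trans ((measure_iUnion_le _).trans ?_)
            exact ENNReal.tsum_le_tsum fun i =>
              OuterMeasure.mkMetric'.pre_le (hsmall _ _ (Nat.le_add_left k i))
        _ = ∑' i, g (ediam (T (ψ m) i : Set X)) := by
            rw [add_comm]
            exact ENNReal.summable.sum_add_tsum_nat_add'
        _ ≤ _ := (hTsum (ψ m)).le
    calc _ ≤ OuterMeasure.mkMetric'.pre (fun s => g (ediam s)) r (E n \ U) +
          ∑ i ∈ Finset.range k, c i := by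
          gcongr
          exact le_max_left _ _
      _ ≤ s := le_of_tendsto_of_tendsto
          (tendsto_const_nhds.add (tendsto_finsetSum _ fun i _ => hc i)) hlim hev
  have hD : OuterMeasure.mkMetric g ((⋃ n, E n) \ U) + ∑' i, c i ≤ s := by
    have hmono : Monotone fun n => E n \ U := fun m n h => sdiff_subset_sdiff_left (hE h)
    rw [iUnion_sdiff, OuterMeasure.coe_mkMetric, hmono.measure_iUnion, ENNReal.iSup_add]
    refine iSup_le fun n => ?_
    rw [← OuterMeasure.coe_mkMetric, OuterMeasure.mkMetric]
    exact le_of_tendsto ((OuterMeasure.mkMetric'.tendsto_pre _ _).add_const _)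
      (eventually_mem_nhdsWithin.mono fun r hr => hpre n r hr)
  calc hausdorffContent X hg.zero (⋃ n, E n)
      ≤ hausdorffContent X hg.zero ((⋃ n, E n) \ U) + hausdorffContent X hg.zero U := by
        refine (measure_mono ?_).trans (measure_union_le _ _)
        rw [sdiff_union_self]
        exact subset_union_left
    _ ≤ OuterMeasure.mkMetric g ((⋃ n, E n) \ U) + ∑' i, (c i + η i) := by
        gcongr
        · exact hausdorffContent_le_mkMetric (X := X) hg.zero
        · exact (measure_iUnion_le _).trans
            (ENNReal.tsum_le_tsum fun i => (hausdorffContent_le _ _).trans (hle i))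
    _ = OuterMeasure.mkMetric g ((⋃ n, E n) \ U) + ∑' i, c i + ∑' i, η i := by
        rw [ENNReal.tsum_add, add_assoc]
    _ ≤ s + ε := add_le_add hD hηsum.le

/-- Continuous images of Baire space are approximated in content from inside by images of
compact boxes. -/
theorem exists_le_hausdorffContent_image_box (hg : IsGauge g) {φ : (ℕ → ℕ) → X}
    (hφ : Continuous φ) {a : ℝ≥0∞} (ha : a < hausdorffContent X hg.zero (range φ)) :
    ∃ b : ℕ → ℕ, a ≤ hausdorffContent X hg.zero (φ '' Iic b) := by
  have step (k : ℕ) (S : Set (ℕ → ℕ)) (h : a < hausdorffContent X hg.zero (φ '' S)) :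
      ∃ n, a < hausdorffContent X hg.zero (φ '' (S ∩ {z | z k ≤ n})) := by
    by_contra! hcon
    have hU : φ '' S = ⋃ n, φ '' (S ∩ {z | z k ≤ n}) := by
      have hk : ⋃ n, {z : ℕ → ℕ | z k ≤ n} = univ := iUnion_eq_univ_iff.2 fun z => ⟨z k, le_refl (z k)⟩
      rw [← image_iUnion, ← inter_iUnion, hk, inter_univ]
    refine h.not_ge (hU ▸ hausdorffContent_iUnion_le hg (fun m n hmn => ?_) hcon)
    exact image_mono (inter_subset_inter_right _ fun z hz => le_trans hz hmn)
  choose! N hN using step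
  let Z : ℕ → Set (ℕ → ℕ) := fun k => Nat.rec univ (fun k S => S ∩ {z | z k ≤ N k S}) k
  have hZ (k : ℕ) : a < hausdorffContent X hg.zero (φ '' Z k) := by
    induction k with
    | zero => simpa [Z] using ha
    | succ k ih => exact hN k _ ih
  let b (k : ℕ) : ℕ := N k (Z k)
  have hZb (k : ℕ) : ∀ z ∈ Z k, ∀ i < k, z i ≤ b i := by
    induction k with
    | zero => simp
    | succ k ih =>
      intro z hz i hi
      rcases Nat.lt_succ_iff_lt_or_eq.1 hi with hi | rfl
      · exact ih z hz.1 i hi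
      · exact hz.2
  refine ⟨b, ?_⟩
  by_contra! hlt
  obtain ⟨U, hUo, hbU, hU⟩ := exists_isOpen_hausdorffContent_lt hg hlt
  have hex (k : ℕ) : ∃ z ∈ Z k, φ z ∉ U := by
    obtain ⟨_, ⟨z, hz, rfl⟩, hzU⟩ := not_subset.1 fun h : φ '' Z k ⊆ U =>
      ((hZ k).trans_le (measure_mono h)).not_gt hU
    exact ⟨z, hz, hzU⟩
  choose z hzZ hzU using hex
  have hcpt : IsCompact (Iic b) := by
    rw [← Icc_bot]
    exact isCompact_Icc
  obtain ⟨w, hw, ψ, hψ, hlim⟩ := hcpt.tendsto_subseq (x := fun k => z k ⊓ b) fun k => mem_Iic.2 inf_le_right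
  have hlim' : Tendsto (z ∘ ψ) atTop (𝓝 w) := by
    refine tendsto_pi_nhds.2 fun i => (tendsto_pi_nhds.1 hlim i).congr' ?_
    filter_upwards [hψ.tendsto_atTop.eventually_gt_atTop i] with m hm
    exact inf_eq_left.2 (hZb _ _ (hzZ (ψ m)) i hm)
  have := ((hφ.tendsto w).comp hlim').eventually (hUo.mem_nhds (hbU (mem_image_of_mem φ hw)))
  obtain ⟨m, hm⟩ := this.exists
  exact hzU _ hm

/-- **Goldstern's principle** for the null ideal of a Hausdorff measure. -/
theorem mkMetric_iUnion_section_eq_zero (hg : IsGauge g) {A : Set ((ℕ → ℕ) × X)}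
    (hA : AnalyticSet A) (hmono : Monotone fun x => {y | (x, y) ∈ A})
    (hnull : ∀ x, OuterMeasure.mkMetric g {y | (x, y) ∈ A} = 0) :
    OuterMeasure.mkMetric g (⋃ x, {y | (x, y) ∈ A}) = 0 := by
  rw [AnalyticSet] at hA
  rcases hA with rfl | ⟨φ, hφ, rfl⟩
  · simp
  have hunion : ⋃ x, {y | (x, y) ∈ range φ} = range fun z => (φ z).2 := by
    ext y
    simp [Prod.ext_iff]
  refine mkMetric_eq_zero_of_hausdorffContent_eq_zero hg ?_
  rw [hunion]
  by_contra hpos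
  obtain ⟨a, ha0, ha⟩ := exists_between (pos_iff_ne_zero.2 hpos)
  obtain ⟨b, hb⟩ := exists_le_hausdorffContent_image_box hg hφ.snd ha
  have hcpt : IsCompact (Iic b) := by
    rw [← Icc_bot]
    exact isCompact_Icc
  obtain ⟨x, hx⟩ : BddAbove ((fun z => (φ z).1) '' Iic b) := by
    refine bddAbove_pi.2 fun i => ?_
    rw [← image_comp]
    exact (hcpt.image ((continuous_apply i).comp hφ.fst)).bddAbove
  have hsub : (fun z => (φ z).2) '' Iic b ⊆ {y | (x, y) ∈ range φ} := by
    rintro _ ⟨z, hz, rfl⟩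
    exact hmono (hx (mem_image_of_mem _ hz)) ⟨z, rfl⟩
  refine (ha0.trans_le (hb.trans (measure_mono hsub))).not_ge ?_
  exact (hausdorffContent_le_mkMetric hg.zero _).trans (hnull x).le

end Content

theorem isGauge_ofReal {f : ℝ → ℝ} (hf0 : f 0 = 0) (hf_mono : MonotoneOn f (Ici 0))
    (hf_cont : ContinuousOn f (Ici 0)) (hf_pos : ∀ t, 0 < t → 0 < f t) :
    IsGauge fun d => ENNReal.ofReal (f d.toReal) where
  zero := by simp [hf0]
  ne_top _ _ := ENNReal.ofReal_ne_top
  mono _ _ hb hab := ENNReal.ofReal_le_ofReal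
    (hf_mono ENNReal.toReal_nonneg ENNReal.toReal_nonneg (ENNReal.toReal_mono hb hab))
  continuousAt d hd := by
    refine ENNReal.continuous_ofReal.continuousAt.comp ?_
    refine (hf_cont d.toReal ENNReal.toReal_nonneg).tendsto.comp ?_
    exact tendsto_nhdsWithin_iff.2 ⟨ENNReal.tendsto_toReal hd,
      Eventually.of_forall fun _ => ENNReal.toReal_nonneg⟩
  pos _ hd hd0 := ENNReal.ofReal_pos.2 (hf_pos _ (ENNReal.toReal_pos hd0.ne' hd))

end HausdorffContent

/-- **GP(Σ¹₁, Hausdorff measure)**: for a continuous doubling gauge function `f` and a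
compact metric space `X`, every monotone analytic `A ⊆ (ℕ → ℕ) × X` whose vertical
sections have `f`-Hausdorff measure zero has union of `f`-Hausdorff measure zero. -/
theorem gp_analytic_hausdorff {X : Type*} [MetricSpace X] [CompactSpace X]
    [MeasurableSpace X] [BorelSpace X]
    (f : ℝ → ℝ) (hf0 : f 0 = 0)
    (hf_mono : MonotoneOn f (Set.Ici 0))
    (hf_cont : ContinuousOn f (Set.Ici 0))
    (hf_doubling : ∃ r : ℝ, 0 < r ∧ ∀ t : ℝ, 0 < t → f (2 * t) < r * f t)
    (A : Set ((ℕ → ℕ) × X)) (hA : AnalyticSet A)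
    (hmono : ∀ x x' : ℕ → ℕ, (∀ n, x n ≤ x' n) →
      {y : X | (x, y) ∈ A} ⊆ {y : X | (x', y) ∈ A})
    (hnull : ∀ x : ℕ → ℕ,
      Measure.mkMetric (fun d : ℝ≥0∞ => ENNReal.ofReal (f d.toReal))
        {y : X | (x, y) ∈ A} = 0) :
    Measure.mkMetric (fun d : ℝ≥0∞ => ENNReal.ofReal (f d.toReal))
      (⋃ x : ℕ → ℕ, {y : X | (x, y) ∈ A}) = 0 := by
  obtain ⟨r, hr, hdoubling⟩ := hf_doubling
  have hpos (t : ℝ) (ht : 0 < t) : 0 < f t := by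
    have h0 : 0 ≤ f (2 * t) := by
      rw [← hf0]
      exact hf_mono Set.self_mem_Ici (Set.mem_Ici.2 (by positivity)) (by positivity)
    exact pos_of_mul_pos_right (h0.trans_lt (hdoubling t ht)) hr.le
  simp only [← OuterMeasure.coe_mkMetric] at hnull ⊢
  exact mkMetric_iUnion_section_eq_zero (isGauge_ofReal hf0 hf_mono hf_cont hpos) hA hmono hnull
end

section
/- Assume GP(all): for every family (A_x)_{x ∈ ℕ → ℕ} of Lebesgue-null subsets of ℝ such that x ≤ x' pointwise implies A_x ⊆ A_{x'}, the union ⋃_{x ∈ ℕ → ℕ} A_x is Lebesgue-null. Then cov(M) ≠ 𝔟: the least cardinality of a family of meagre subsets of ℝ whose union is all of ℝ is not equal to the least cardinality of an unbounded family in ℕ → ℕ under eventual domination. -/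
open MeasureTheory

/-- `cov(M)`: the least cardinality of a family of meagre subsets of `ℝ` covering `ℝ`. -/
noncomputable def covMeagre : Cardinal :=
  sInf {c : Cardinal | ∃ F : Set (Set ℝ), Cardinal.mk F = c ∧
    (∀ S ∈ F, IsMeagre S) ∧ ⋃₀ F = Set.univ}

/-- `𝔟`: the least cardinality of a family in `ℕ → ℕ` unbounded under eventual
domination. -/
noncomputable def boundingNumber : Cardinal :=
  sInf {c : Cardinal | ∃ F : Set (ℕ → ℕ), Cardinal.mk F = c ∧
    ¬∃ g : ℕ → ℕ, ∀ f ∈ F, ∀ᶠ n in Filter.atTop, f n ≤ g n}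

lemma covMeagre_le {F : Set (Set ℝ)} (hF : ∀ S ∈ F, IsMeagre S) (hU : ⋃₀ F = Set.univ) :
    covMeagre ≤ Cardinal.mk F :=
  csInf_le' ⟨F, rfl, hF, hU⟩

lemma exists_cover_mk_eq_covMeagre : ∃ F : Set (Set ℝ), Cardinal.mk F = covMeagre ∧
    (∀ S ∈ F, IsMeagre S) ∧ ⋃₀ F = Set.univ := by
  refine csInf_mem (s := {c : Cardinal | ∃ F : Set (Set ℝ), Cardinal.mk F = c ∧
    (∀ S ∈ F, IsMeagre S) ∧ ⋃₀ F = Set.univ}) ⟨_, Set.range fun x : ℝ => {x}, rfl, ?_, ?_⟩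
  · rintro _ ⟨x, rfl⟩
    refine IsNowhereDense.isMeagre ?_
    rw [isClosed_singleton.isNowhereDense_iff, interior_singleton]
  · exact Set.eq_univ_of_forall fun x => ⟨{x}, ⟨x, rfl⟩, rfl⟩

lemma boundingNumber_le {F : Set (ℕ → ℕ)}
    (hF : ¬∃ g : ℕ → ℕ, ∀ f ∈ F, ∀ᶠ n in Filter.atTop, f n ≤ g n) :
    boundingNumber ≤ Cardinal.mk F :=
  csInf_le' ⟨F, rfl, hF⟩

lemma exists_unbounded_mk_eq_boundingNumber : ∃ F : Set (ℕ → ℕ), Cardinal.mk F = boundingNumber ∧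
    ¬∃ g : ℕ → ℕ, ∀ f ∈ F, ∀ᶠ n in Filter.atTop, f n ≤ g n := by
  refine csInf_mem (s := {c : Cardinal | ∃ F : Set (ℕ → ℕ), Cardinal.mk F = c ∧
    ¬∃ g : ℕ → ℕ, ∀ f ∈ F, ∀ᶠ n in Filter.atTop, f n ≤ g n}) ⟨_, Set.univ, rfl, ?_⟩
  rintro ⟨g, hg⟩
  obtain ⟨n, hn⟩ := (hg (fun n => g n + 1) (Set.mem_univ _)).exists
  simp at hn

/-- A subset of the line is nowhere dense if every nonempty open set has a nonempty open subset
missing it. -/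
lemma isNowhereDense_of_forall_open {A : Set ℝ}
    (h : ∀ O : Set ℝ, IsOpen O → O.Nonempty →
      ∃ O' ⊆ O, IsOpen O' ∧ O'.Nonempty ∧ Disjoint O' A) : IsNowhereDense A := by
  rw [IsNowhereDense, Set.eq_empty_iff_forall_notMem]
  intro x hx
  obtain ⟨O', hO, ho, ⟨y, hy⟩, hd⟩ := h _ isOpen_interior ⟨x, hx⟩
  have hy' : y ∈ closure A := interior_subset (hO hy)
  obtain ⟨z, hz, hzA⟩ := mem_closure_iff.1 hy' O' ho hy
  exact Set.disjoint_left.1 hd hz hzA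

/-- The digit functions `g n x = ⌊1 / fract (2 ^ n x)⌋` take every positive value on an open subset of
any prescribed nonempty open set, once `n` is large enough. -/
lemma exists_open_digit_eq {O : Set ℝ} (hO : IsOpen O) (hne : O.Nonempty) (N : ℕ) :
    ∃ n ≥ N, ∀ j : ℕ, ∃ O' ⊆ O, IsOpen O' ∧ O'.Nonempty ∧
      ∀ x ∈ O', ⌊(Int.fract (2 ^ n * x))⁻¹⌋₊ = j + 1 := by
  obtain ⟨x, hx⟩ := hne
  obtain ⟨ε, hε, hball⟩ := Metric.isOpen_iff.1 hO x hx
  obtain ⟨m, hm⟩ := exists_pow_lt_of_lt_one hε (by norm_num : (1 / 2 : ℝ) < 1)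
  set n := max m N
  have hn : (1 / 2 : ℝ) ^ n < ε :=
    (pow_le_pow_of_le_one (by norm_num) (by norm_num) (le_max_left m N)).trans_lt hm
  refine ⟨n, le_max_right _ _, fun j => ?_⟩
  have hp : (0 : ℝ) < 2 ^ n := by positivity
  set k : ℤ := ⌊2 ^ n * x⌋
  have hk1 : (k : ℝ) ≤ 2 ^ n * x := Int.floor_le _
  have hk2 : 2 ^ n * x < k + 1 := Int.lt_floor_add_one _
  have hj : (0 : ℝ) < (j : ℝ) + 1 := by positivity
  have hj2 : (0 : ℝ) < (j : ℝ) + 2 := by positivity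
  have hlt : ((j : ℝ) + 2)⁻¹ < ((j : ℝ) + 1)⁻¹ := by
    rw [inv_lt_inv₀ hj2 hj]; linarith
  have hle : ((j : ℝ) + 1)⁻¹ ≤ 1 := inv_le_one_of_one_le₀ (by linarith [Nat.cast_nonneg (α := ℝ) j])
  have h0 : 0 < ((j : ℝ) + 2)⁻¹ := by positivity
  have hmul : (1 / 2 : ℝ) ^ n * 2 ^ n = 1 := by rw [← mul_pow]; norm_num
  refine ⟨Set.Ioo ((k + ((j : ℝ) + 2)⁻¹) / 2 ^ n) ((k + ((j : ℝ) + 1)⁻¹) / 2 ^ n), ?_, isOpen_Ioo, ?_, ?_⟩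
  · intro y hy
    apply hball
    rw [Set.mem_Ioo, div_lt_iff₀ hp, lt_div_iff₀ hp] at hy
    rw [Metric.mem_ball, Real.dist_eq, abs_lt]
    constructor
    · by_contra hcon
      nlinarith
    · by_contra hcon
      nlinarith
  · rw [Set.nonempty_Ioo]
    gcongr
  · intro y hy
    rw [Set.mem_Ioo, div_lt_iff₀ hp, lt_div_iff₀ hp] at hy
    have hfr : Int.fract (2 ^ n * y) = 2 ^ n * y - k := by
      rw [Int.fract_eq_iff]
      refine ⟨by linarith, by linarith, k, by ring⟩
    rw [hfr, Nat.floor_eq_iff (by apply inv_nonneg.2; linarith)]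
    have hpos : 0 < 2 ^ n * y - k := by linarith
    push_cast
    constructor
    · rw [le_inv_comm₀ hj hpos]; linarith
    · rw [inv_lt_comm₀ hpos (by linarith)]
      have : (j : ℝ) + 1 + 1 = j + 2 := by ring
      rw [this]; linarith

/-- There are countably many open sets, of prescribed small measure, that suffice to cover all compact
null sets. -/
lemma exists_seq_cover_compact_null {ε : ENNReal} (hε : 0 < ε) :
    ∃ U : ℕ → Set ℝ, (∀ j, volume (U j) ≤ ε) ∧
      ∀ C : Set ℝ, IsCompact C → volume C = 0 → ∃ j, C ⊆ U j := by
  classical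
  let V : Finset (ℚ × ℚ) → Set ℝ := fun v => ⋃ q ∈ v, Set.Ioo (q.1 : ℝ) q.2
  let U : ℕ → Set ℝ := fun j =>
    match Encodable.decode (α := Finset (ℚ × ℚ)) j with
    | some v => if volume (V v) ≤ ε then V v else ∅
    | none => ∅
  refine ⟨U, fun j => ?_, fun C hC h0 => ?_⟩
  · simp only [U]
    split
    · split_ifs with h
      · exact h
      · simp
    · simp
  · obtain ⟨O, hCO, hO, hOε⟩ := C.exists_isOpen_lt_of_lt ε (h0 ▸ hε)
    have key : ∀ x, ∃ q : ℚ × ℚ, x ∈ C → x ∈ Set.Ioo (q.1 : ℝ) q.2 ∧ Set.Ioo (q.1 : ℝ) q.2 ⊆ O := by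
      intro x
      by_cases hx : x ∈ C
      · obtain ⟨δ, hδ, hball⟩ := Metric.isOpen_iff.1 hO x (hCO hx)
        obtain ⟨a, ha1, ha2⟩ := exists_rat_btwn (show x - δ < x by linarith)
        obtain ⟨b, hb1, hb2⟩ := exists_rat_btwn (show x < x + δ by linarith)
        refine ⟨(a, b), fun _ => ⟨⟨ha2, hb1⟩, fun y hy => hball ?_⟩⟩
        rw [Metric.mem_ball, Real.dist_eq, abs_lt]
        have h1 : (a : ℝ) < y := hy.1
        have h2 : y < (b : ℝ) := hy.2
        constructor <;> linarith
      · exact ⟨(0, 0), fun h => absurd h hx⟩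
    choose q hq using key
    obtain ⟨t, htC, ht⟩ := hC.elim_nhds_subcover (fun x => Set.Ioo ((q x).1 : ℝ) (q x).2)
      (fun x hx => isOpen_Ioo.mem_nhds (hq x hx).1)
    refine ⟨Encodable.encode (t.image q), ?_⟩
    have hV : V (t.image q) ⊆ O := by
      simp only [V, Finset.mem_image, Set.iUnion_subset_iff]
      rintro _ ⟨x, hx, rfl⟩
      exact (hq x (htC x hx)).2
    have hCV : C ⊆ V (t.image q) := by
      intro x hx
      obtain ⟨z, hz, hxz⟩ := Set.mem_iUnion₂.1 (ht hx)
      exact Set.mem_iUnion₂.2 ⟨q z, Finset.mem_image_of_mem _ hz, hxz⟩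
    have hle : volume (V (t.image q)) ≤ ε := (measure_mono hV).trans hOε.le
    simp only [U, Encodable.encodek, if_pos hle]
    exact hCV

/-- Fewer than `cov(M)` compact null sets have a null union. -/
lemma volume_iUnion_compact_null_of_lt_covMeagre {I : Type} (hI : Cardinal.mk I < covMeagre)
    (E : I → ℕ → Set ℝ) (hc : ∀ i k, IsCompact (E i k)) (h0 : ∀ i k, volume (E i k) = 0) :
    volume (⋃ i, ⋃ k, E i k) = 0 := by
  obtain ⟨ε, hε, hsum⟩ := ENNReal.exists_pos_sum_of_countable (ε := 1) one_ne_zero ℕ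
  choose U hU hcov using fun n => exists_seq_cover_compact_null (ENNReal.coe_pos.2 (hε n))
  let g : ℕ → ℝ → ℕ := fun n x => ⌊(Int.fract (2 ^ n * x))⁻¹⌋₊ - 1
  let G : I → ℕ → ℕ → Set ℝ := fun i k N => {x | ∀ n ≥ N, ¬ E i k ⊆ U n (g n x)}
  have hG : ∀ i k N, IsNowhereDense (G i k N) := by
    intro i k N
    refine isNowhereDense_of_forall_open fun O hO hne => ?_
    obtain ⟨n, hn, h⟩ := exists_open_digit_eq hO hne N
    obtain ⟨j, hj⟩ := hcov n (E i k) (hc i k) (h0 i k)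
    obtain ⟨O', hO', ho, hne', hg⟩ := h j
    refine ⟨O', hO', ho, hne', Set.disjoint_left.2 fun x hx hxG => hxG n hn ?_⟩
    have : g n x = j := by simp only [g, hg x hx, Nat.add_sub_cancel]
    rw [this]
    exact hj
  let M : I → Set ℝ := fun i => ⋃ k, ⋃ N, G i k N
  have hM : ∀ i, IsMeagre (M i) := fun i =>
    isMeagre_iUnion fun k => isMeagre_iUnion fun N => (hG i k N).isMeagre
  have hnot : ⋃₀ Set.range M ≠ Set.univ := by
    intro h
    refine (covMeagre_le ?_ h).not_gt (Cardinal.mk_range_le.trans_lt hI)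
    rintro _ ⟨i, rfl⟩
    exact hM i
  obtain ⟨x, hx⟩ := (Set.ne_univ_iff_exists_notMem _).1 hnot
  have hsub : (⋃ i, ⋃ k, E i k) ⊆ {y | ∃ᶠ n in Filter.atTop, y ∈ U n (g n x)} := by
    refine Set.iUnion₂_subset fun i k y hy => ?_
    refine Filter.frequently_atTop.2 fun N => ?_
    by_contra hcon
    apply hx
    refine ⟨M i, ⟨i, rfl⟩, Set.mem_iUnion₂.2 ⟨k, N, fun n hn hE => hcon ⟨n, hn, hE hy⟩⟩⟩
  refine measure_mono_null hsub (measure_setOfPred_frequently_eq_zero (ne_top_of_le_ne_top ?_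
    (ENNReal.tsum_le_tsum fun n => hU n (g n x))))
  exact (hsum.trans ENNReal.one_lt_top).ne

/-- Under `GP(all)`, if `cov(M) = 𝔟` then `cov(M)` many compact null sets have a null union. -/
lemma volume_iUnion_compact_null_of_gp
    (hGP : ∀ A : (ℕ → ℕ) → Set ℝ,
      (∀ x, volume (A x) = 0) →
      (∀ x x' : ℕ → ℕ, (∀ n, x n ≤ x' n) → A x ⊆ A x') →
      volume (⋃ x : ℕ → ℕ, A x) = 0)
    (hcb : covMeagre = boundingNumber) {I : Type} (hI : Cardinal.mk I = covMeagre)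
    (E : I → ℕ → Set ℝ) (hc : ∀ i k, IsCompact (E i k)) (h0 : ∀ i k, volume (E i k) = 0) :
    volume (⋃ i, ⋃ k, E i k) = 0 := by
  obtain ⟨F, hF, hunb⟩ := exists_unbounded_mk_eq_boundingNumber
  let J := covMeagre.ord.ToType
  have hIio : ∀ a : covMeagre.ord.ToType, Cardinal.mk (Set.Iio a) < covMeagre := fun a => by
    simpa using Cardinal.mk_Iio_lt a
  have hJ : Cardinal.mk J = covMeagre := Cardinal.mk_ord_toType _
  obtain ⟨eF⟩ : Nonempty (J ≃ F) := Cardinal.eq.1 (hJ.trans (hcb.trans hF.symm))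
  obtain ⟨eI⟩ : Nonempty (J ≃ I) := Cardinal.eq.1 (hJ.trans hI.symm)
  let f : J → ℕ → ℕ := fun j => (eF j : ℕ → ℕ)
  let P : (ℕ → ℕ) → J → Prop := fun x j => ∀ γ ≤ j, ∀ᶠ n in Filter.atTop, f γ n ≤ x n
  let A : (ℕ → ℕ) → Set ℝ := fun x => ⋃ j : {j // P x j}, ⋃ k, E (eI j) k
  have hA : volume (⋃ x, A x) = 0 := by
    refine hGP A (fun x => ?_) fun x x' hxx => ?_
    · obtain ⟨a, ha⟩ : ∃ a, ¬ ∀ᶠ n in Filter.atTop, f a n ≤ x n := by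
        by_contra! hcon
        refine hunb ⟨x, fun φ hφ => ?_⟩
        simpa [f] using hcon (eF.symm ⟨φ, hφ⟩)
      refine volume_iUnion_compact_null_of_lt_covMeagre ?_ (fun j : {j // P x j} => E (eI j))
        (fun _ => hc _) (fun _ => h0 _)
      refine lt_of_le_of_lt (Cardinal.mk_le_mk_of_subset (s := {j | P x j}) (t := Set.Iio a) ?_)
        (hIio a)
      intro j hj
      by_contra hlt
      exact ha (hj a (not_lt.1 hlt))
    · refine Set.iUnion_subset fun j => ?_
      exact Set.subset_iUnion (fun j : {j // P x' j} => ⋃ k, E (eI j) k)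
        ⟨j, fun γ hγ => (j.2 γ hγ).mono fun n hn => hn.trans (hxx n)⟩
  refine measure_mono_null (Set.iUnion_subset fun i => ?_) hA
  let j := eI.symm i
  obtain ⟨x, hx⟩ : ∃ x : ℕ → ℕ, ∀ φ ∈ f '' Set.Iio j, ∀ᶠ n in Filter.atTop, φ n ≤ x n := by
    by_contra hcon
    refine (boundingNumber_le hcon).not_gt ?_
    rw [← hcb]
    exact Cardinal.mk_image_le.trans_lt (hIio j)
  have hP : P (fun n => max (x n) (f j n)) j := by
    intro γ hγ
    rcases hγ.lt_or_eq with h | rfl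
    · exact (hx _ ⟨γ, h, rfl⟩).mono fun n hn => hn.trans (le_max_left _ _)
    · exact Filter.Eventually.of_forall fun n => le_max_right _ _
  refine subset_trans ?_ (Set.subset_iUnion A (fun n => max (x n) (f j n)))
  have := Set.subset_iUnion (fun j : {l // P (fun n => max (x n) (f j n)) l} => ⋃ k, E (eI j) k) ⟨j, hP⟩
  simpa [j] using this

/-- Dilations by powers of two of a `1`-periodic set contained, modulo `1`, in one half of the unit
interval behave like (sub)independent events of probability `1 / 2`. -/
lemma volume_dyadic_inter_le {D : Set ℝ} (hD : ∀ (x : ℝ) (n : ℕ), x + n ∈ D ↔ x ∈ D) {c : ℕ}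
    (hc : D ∩ Set.Ico 0 1 ⊆ Set.Icc (c / 2 : ℝ) ((c + 1) / 2)) (n : ℕ) :
    ∀ T ⊆ Finset.range n,
      volume {x ∈ Set.Ico (0 : ℝ) 1 | ∀ q ∈ T, 2 ^ q * x ∈ D} ≤ 2⁻¹ ^ T.card := by
  classical
  induction n with
  | zero =>
    intro T hT
    have : T = ∅ := by simpa using hT
    subst this
    exact (measure_mono fun x hx => hx.1).trans (by simp : volume (Set.Ico (0 : ℝ) 1) ≤ _)
  | succ n ih =>
    intro T hT
    set T' : Finset ℕ := (T.erase 0).image Nat.pred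
    have hcard : T'.card = (T.erase 0).card := by
      refine Finset.card_image_of_injOn fun a ha b hb hab => ?_
      have ha' : a ≠ 0 := (Finset.mem_erase.1 ha).1
      have hb' : b ≠ 0 := (Finset.mem_erase.1 hb).1
      exact Nat.pred_inj (Nat.pos_of_ne_zero ha') (Nat.pos_of_ne_zero hb') hab
    have hT' : T' ⊆ Finset.range n := by
      intro q hq
      obtain ⟨a, ha, rfl⟩ := Finset.mem_image.1 hq
      obtain ⟨ha0, haT⟩ := Finset.mem_erase.1 ha
      have := Finset.mem_range.1 (hT haT)
      rw [Finset.mem_range, Nat.pred_eq_sub_one]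
      omega
    let P : Set ℝ := {x | ∀ q ∈ T', 2 ^ q * x ∈ D}
    have hPper : ∀ (x : ℝ) (k : ℕ), x + k ∈ P ↔ x ∈ P := by
      intro x k
      refine forall₂_congr fun q _ => ?_
      rw [← hD (2 ^ q * x) (2 ^ q * k)]
      push_cast
      rw [mul_add]
    have hI : volume (P ∩ Set.Ico 0 1) ≤ 2⁻¹ ^ T'.card := by
      refine le_trans (measure_mono ?_) (ih T' hT')
      exact fun x hx => ⟨hx.2, hx.1⟩
    have hshift : ∀ k : ℕ, volume (P ∩ Set.Ico k (k + 1)) = volume (P ∩ Set.Ico 0 1) := by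
      intro k
      rw [← measure_preimage_add_right volume (k : ℝ) (P ∩ Set.Ico k (k + 1))]
      congr 1
      ext x
      simp only [Set.mem_preimage, Set.mem_inter_iff, hPper, Set.mem_Ico]
      refine and_congr_right fun _ => ?_
      constructor <;> rintro ⟨h1, h2⟩ <;> constructor <;> linarith
    have hdil : ∀ s : Set ℝ, volume ((fun x => (2 : ℝ) * x) ⁻¹' s) = 2⁻¹ * volume s := by
      intro s
      rw [Real.volume_preimage_mul_left two_ne_zero, abs_of_pos (by norm_num),
        ENNReal.ofReal_inv_of_pos two_pos, ENNReal.ofReal_ofNat]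
    have hmem : ∀ x, (∀ q ∈ T, 2 ^ q * x ∈ D) → 2 * x ∈ P := by
      intro x hx q hq
      obtain ⟨a, ha, rfl⟩ := Finset.mem_image.1 hq
      obtain ⟨ha0, haT⟩ := Finset.mem_erase.1 ha
      obtain ⟨b, rfl⟩ := Nat.exists_eq_succ_of_ne_zero ha0
      have := hx _ haT
      rwa [pow_succ, mul_assoc] at this
    by_cases h0 : 0 ∈ T
    · have hT1 : T.card = T'.card + 1 := by rw [hcard, Finset.card_erase_add_one h0]
      have hsub : {x ∈ Set.Ico (0 : ℝ) 1 | ∀ q ∈ T, 2 ^ q * x ∈ D} ⊆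
          (fun x => (2 : ℝ) * x) ⁻¹' (P ∩ Set.Ico c (c + 1)) ∪ {((c : ℝ) + 1) / 2} := by
        rintro x ⟨hx, hxT⟩
        have hxD : x ∈ D := by simpa using hxT 0 h0
        obtain ⟨h1, h2⟩ := hc ⟨hxD, hx⟩
        rcases h2.lt_or_eq with h2 | h2
        · exact Or.inl ⟨hmem x hxT, by constructor <;> linarith⟩
        · exact Or.inr h2
      calc _ ≤ _ := measure_mono hsub
        _ ≤ _ := measure_union_le _ _
        _ = 2⁻¹ * volume (P ∩ Set.Ico 0 1) := by
          rw [hdil, hshift, Real.volume_singleton, add_zero]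
        _ ≤ _ := by
          rw [hT1, pow_succ, mul_comm]
          gcongr
    · have hT1 : T.card = T'.card := by rw [hcard, Finset.erase_eq_of_notMem h0]
      have hsub : {x ∈ Set.Ico (0 : ℝ) 1 | ∀ q ∈ T, 2 ^ q * x ∈ D} ⊆
          (fun x => (2 : ℝ) * x) ⁻¹' (P ∩ Set.Ico (0 : ℕ) ((0 : ℕ) + 1) ∪
            P ∩ Set.Ico (1 : ℕ) ((1 : ℕ) + 1)) := by
        rintro x ⟨hx, hxT⟩
        rw [Set.mem_preimage, ← Set.inter_union_distrib_left]
        refine ⟨hmem x hxT, ?_⟩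
        rcases lt_or_ge (2 * x) 1 with h | h
        · left; constructor
          · push_cast; linarith [hx.1]
          · push_cast; linarith
        · right; constructor
          · push_cast; linarith
          · push_cast; linarith [hx.2]
      calc _ ≤ _ := measure_mono hsub
        _ ≤ 2⁻¹ * (volume (P ∩ Set.Ico 0 1) + volume (P ∩ Set.Ico 0 1)) := by
          rw [hdil]
          gcongr
          refine (measure_union_le _ _).trans ?_
          rw [hshift, hshift]
        _ = volume (P ∩ Set.Ico 0 1) := by
          rw [← two_mul, ← mul_assoc, ENNReal.inv_mul_cancel two_ne_zero ENNReal.ofNat_ne_top, one_mul]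
        _ ≤ _ := hT1 ▸ hI

/-- Points of the line at which the `q`-th square wave is nonnegative. -/
def waveSet (q : ℕ) : Set ℝ := {x | 0 ≤ Real.sin (2 * Real.pi * (2 ^ q * x))}

lemma isClosed_waveSet (q : ℕ) : IsClosed (waveSet q) :=
  isClosed_le continuous_const (by fun_prop)

lemma sin_two_pi_mul_add_nat (x : ℝ) (n : ℕ) :
    Real.sin (2 * Real.pi * (x + n)) = Real.sin (2 * Real.pi * x) := by
  rw [mul_add, mul_comm (2 * Real.pi) (n : ℝ), Real.sin_add_nat_mul_two_pi]

lemma volume_waveSet_inter_le (T : Finset ℕ) :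
    volume {x ∈ Set.Ico (0 : ℝ) 1 | ∀ q ∈ T, x ∈ waveSet q} ≤ 2⁻¹ ^ T.card := by
  obtain ⟨n, hn⟩ := T.exists_nat_subset_range
  refine volume_dyadic_inter_le (D := {x | 0 ≤ Real.sin (2 * Real.pi * x)}) (c := 0)
    (fun x n => ?_) ?_ n T hn
  · change 0 ≤ Real.sin _ ↔ 0 ≤ Real.sin _
    rw [sin_two_pi_mul_add_nat]
  · rintro x ⟨hx, h0, h1⟩
    refine ⟨by simpa using h0, ?_⟩
    by_contra! hlt
    push_cast at hlt
    have h2 : Real.sin (2 * Real.pi * x - 2 * Real.pi) < 0 := by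
      apply Real.sin_neg_of_neg_of_neg_pi_lt <;> nlinarith [Real.pi_pos]
    rw [Real.sin_sub_two_pi] at h2
    exact absurd hx (not_le.2 h2)

lemma volume_waveSet_compl_inter_le (T : Finset ℕ) :
    volume {x ∈ Set.Ico (0 : ℝ) 1 | ∀ q ∈ T, x ∉ waveSet q} ≤ 2⁻¹ ^ T.card := by
  obtain ⟨n, hn⟩ := T.exists_nat_subset_range
  refine volume_dyadic_inter_le (D := {x | ¬ 0 ≤ Real.sin (2 * Real.pi * x)}) (c := 1)
    (fun x n => ?_) ?_ n T hn
  · change ¬ 0 ≤ _ ↔ ¬ 0 ≤ _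
    rw [sin_two_pi_mul_add_nat]
  · rintro x ⟨hx, h0, h1⟩
    refine ⟨?_, by push_cast; linarith⟩
    by_contra! hlt
    push_cast at hlt
    refine hx (Real.sin_nonneg_of_nonneg_of_le_pi ?_ ?_) <;> nlinarith [Real.pi_pos]

lemma volume_waveSet_inter_eq_zero {S : Set ℕ} (hS : S.Infinite) :
    volume (Set.Icc (0 : ℝ) 1 ∩ ⋂ q : S, waveSet q) = 0 := by
  have h : ∀ n : ℕ, volume (Set.Icc (0 : ℝ) 1 ∩ ⋂ q : S, waveSet q) ≤ 2⁻¹ ^ n := by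
    intro n
    obtain ⟨T, hTS, hT⟩ := hS.exists_subset_card_eq n
    rw [← hT]
    refine (measure_mono (t := {x ∈ Set.Ico (0 : ℝ) 1 | ∀ q ∈ T, x ∈ waveSet q} ∪ {1}) ?_).trans
      ((measure_union_le _ _).trans ?_)
    · rintro x ⟨⟨h0, h1⟩, hx⟩
      rcases h1.lt_or_eq with h1 | h1
      · exact Or.inl ⟨⟨h0, h1⟩, fun q hq => Set.mem_iInter.1 hx ⟨q, hTS hq⟩⟩
      · exact Or.inr h1
    · rw [Real.volume_singleton, add_zero]
      exact volume_waveSet_inter_le T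
  refine le_antisymm (ge_of_tendsto' (ENNReal.tendsto_pow_atTop_nhds_zero_of_lt_one ?_) h) zero_le
  exact ENNReal.inv_lt_one.2 ENNReal.one_lt_two

/-- A set of measure at least `m` has small intersection with a bounded number of the sets
`waveSet q` only, the bounds depending only on `m`. -/
lemma exists_card_waveSet_le {m : ENNReal} (hm : 0 < m) (hm' : m ≠ ⊤) :
    ∃ (N : ℕ) (δ : ENNReal), 0 < δ ∧ δ ≠ ⊤ ∧ δ ≤ m ∧ ∀ A ⊆ Set.Ico (0 : ℝ) 1, m ≤ volume A →
      ∃ B : Finset ℕ, B.card ≤ N ∧ ∀ q ∉ B, δ ≤ volume (A ∩ waveSet q) := by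
  classical
  have hm2 : 0 < m / 2 := ENNReal.half_pos hm.ne'
  obtain ⟨N, hN⟩ := ((ENNReal.tendsto_pow_atTop_nhds_zero_of_lt_one
    (ENNReal.inv_lt_one.2 ENNReal.one_lt_two)).eventually (gt_mem_nhds hm2)).exists
  have hmt : m / 2 ≠ ⊤ := (ENNReal.half_le_self.trans_lt hm'.lt_top).ne
  refine ⟨N, m / 2 / (N + 1), ?_, ?_, ?_, fun A hA hAm => ?_⟩
  · exact ENNReal.div_pos hm2.ne' (by finiteness)
  · exact ENNReal.div_ne_top hmt (by simp)
  · refine le_trans (ENNReal.div_le_of_le_mul ?_) ENNReal.half_le_self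
    exact le_mul_of_one_le_right' (by simp)
  · have hbound : ∀ R : Finset ℕ, (∀ q ∈ R, volume (A ∩ waveSet q) < m / 2 / (N + 1)) → R.card ≤ N := by
      intro R hR
      by_contra! hcard
      obtain ⟨T, hTR, hT⟩ := Finset.exists_subset_card_eq hcard.le
      have hsub : A ⊆ (⋃ q ∈ T, A ∩ waveSet q) ∪ {x ∈ Set.Ico (0 : ℝ) 1 | ∀ q ∈ T, x ∉ waveSet q} := by
        intro x hx
        by_cases h : ∃ q ∈ T, x ∈ waveSet q
        · obtain ⟨q, hq, hxq⟩ := h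
          exact Or.inl (Set.mem_iUnion₂.2 ⟨q, hq, hx, hxq⟩)
        · push Not at h
          exact Or.inr ⟨hA hx, h⟩
      have h1 : volume (⋃ q ∈ T, A ∩ waveSet q) ≤ m / 2 := by
        refine (measure_biUnion_finset_le _ _).trans ?_
        refine (Finset.sum_le_card_nsmul _ _ _ fun q hq => (hR q (hTR hq)).le).trans ?_
        rw [hT, nsmul_eq_mul, mul_comm]
        calc m / 2 / (N + 1) * N ≤ m / 2 / (N + 1) * (N + 1) := by
              gcongr
              exact le_self_add
          _ = m / 2 := ENNReal.div_mul_cancel (by simp) (by finiteness)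
      have h2 := volume_waveSet_compl_inter_le T
      rw [hT] at h2
      have h3 : m < m / 2 + m / 2 :=
        calc m ≤ volume A := hAm
          _ ≤ _ := (measure_mono hsub).trans (measure_union_le _ _)
          _ ≤ m / 2 + 2⁻¹ ^ N := add_le_add h1 h2
          _ < m / 2 + m / 2 := ENNReal.add_lt_add_left hmt hN
      rw [ENNReal.add_halves] at h3
      exact lt_irrefl _ h3
    have hfin : {q | volume (A ∩ waveSet q) < m / 2 / (N + 1)}.Finite := by
      by_contra hinf
      obtain ⟨R, hR, hRc⟩ := Set.Infinite.exists_subset_card_eq hinf (N + 1)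
      have := hbound R fun q hq => hR hq
      omega
    refine ⟨hfin.toFinset, hbound _ fun q hq => by simpa using hq, fun q hq => ?_⟩
    simpa using hq

/-- If `I`-many compact null sets always have a null union, then any `I`-indexed family of infinite
sets of pairs admits a single predictor `B`, with prescribed finite widths, that guesses a later
element of each of them from finitely many earlier ones. -/
lemma exists_predictor : ∃ N : ℕ → ℕ, ∀ {I : Type},
    (∀ E : I → ℕ → Set ℝ, (∀ i k, IsCompact (E i k)) → (∀ i k, volume (E i k) = 0) →
      volume (⋃ i, ⋃ k, E i k) = 0) →
    ∀ S : I → Set (ℕ × ℕ), (∀ i k, (S i ∩ {q | k ≤ q.1}).Infinite) →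
    ∃ B : Finset (ℕ × ℕ) → Finset (ℕ × ℕ), (∀ T, (B T).card ≤ N T.card) ∧
      ∀ i k, ∃ (T : Finset (ℕ × ℕ)) (q : ℕ × ℕ), ↑T ⊆ S i ∧ q ∈ S i ∧ q ∉ T ∧
        (∀ t ∈ T, t.1 ≤ q.1) ∧ k ≤ q.1 ∧ q ∈ B T := by
  classical
  choose Nf δf hδ0 hδt hδm hδ using
    fun m : {m : ENNReal // 0 < m ∧ m ≠ ⊤} => exists_card_waveSet_le m.2.1 m.2.2
  let ms : ℕ → {m : ENNReal // 0 < m ∧ m ≠ ⊤} := fun n =>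
    Nat.rec ⟨1 / 2, by simp, by simp⟩ (fun _ m => ⟨δf m, hδ0 m, hδt m⟩) n
  have hms : ∀ n, (ms (n + 1) : ENNReal) = δf (ms n) := fun n => rfl
  refine ⟨fun j => Nf (ms j), fun {I} hnull S hS => ?_⟩
  let e := Nat.pairEquiv
  let E : I → ℕ → Set ℝ := fun i k =>
    Set.Icc 0 1 ∩ ⋂ q : ↥(S i ∩ {q | k ≤ q.1}), waveSet (e q)
  have hE0 : volume (⋃ i, ⋃ k, E i k) = 0 := by
    refine hnull E (fun i k => ?_) fun i k => ?_
    · exact isCompact_Icc.inter_right (isClosed_iInter fun q => isClosed_waveSet _)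
    · refine measure_mono_null ?_
        (volume_waveSet_inter_eq_zero ((hS i k).image e.injective.injOn))
      rintro x ⟨hx, hxE⟩
      refine ⟨hx, Set.mem_iInter.2 ?_⟩
      rintro ⟨_, q, hq, rfl⟩
      exact Set.mem_iInter.1 hxE ⟨q, hq⟩
  set H := ⋃ i, ⋃ k, E i k
  have hH : volume (Set.Ico (0 : ℝ) 1 \ toMeasurable volume H) = 1 := by
    rw [measure_sdiff_null (by rw [measure_toMeasurable, hE0])]
    simp
  obtain ⟨K, hK, hKc, hKm⟩ := MeasurableSet.exists_lt_isCompact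
    (measurableSet_Ico.diff (measurableSet_toMeasurable volume H))
    (show (1 / 2 : ENNReal) < volume (Set.Ico (0 : ℝ) 1 \ toMeasurable volume H) by
      rw [hH]; simp)
  let KT : Finset (ℕ × ℕ) → Set ℝ := fun T => K ∩ ⋂ q ∈ T, waveSet (e q)
  have hB : ∀ T, ∃ B : Finset (ℕ × ℕ), B.card ≤ Nf (ms T.card) ∧
      (((ms T.card).1 : ENNReal) ≤ volume (KT T) →
        ∀ q ∉ B, δf (ms T.card) ≤ volume (KT T ∩ waveSet (e q))) := by
    intro T
    by_cases hT : ((ms T.card).1 : ENNReal) ≤ volume (KT T)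
    · obtain ⟨B, hB, h⟩ := hδ (ms T.card) (KT T) (fun x hx => (hK hx.1).1) hT
      refine ⟨B.map e.symm.toEmbedding, by rwa [Finset.card_map], fun _ q hq => h _ fun hqB => hq ?_⟩
      exact Finset.mem_map.2 ⟨e q, hqB, e.symm_apply_apply q⟩
    · exact ⟨∅, by simp, fun h => absurd h hT⟩
  choose B hBc hBg using hB
  refine ⟨B, hBc, fun i k => ?_⟩
  by_contra! hcon
  have hgood : ∀ T : Finset (ℕ × ℕ), ↑T ⊆ S i ∩ {q | k ≤ q.1} →
      ((ms T.card).1 : ENNReal) ≤ volume (KT T) := by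
    intro T
    induction T using Finset.induction_on_max_value (fun q : ℕ × ℕ => q.1) with
    | empty =>
      intro _
      simpa [KT, ms] using hKm.le
    | insert q T hqT hmax ih =>
      intro hsub
      rw [Finset.coe_insert, Set.insert_subset_iff] at hsub
      have hqB := hcon T q (hsub.2.trans Set.inter_subset_left) hsub.1.1 hqT hmax hsub.1.2
      have := hBg T (ih hsub.2) q hqB
      rw [Finset.card_insert_of_notMem hqT, hms]
      refine this.trans (measure_mono ?_)
      rintro x ⟨⟨hxK, hxT⟩, hxq⟩
      refine ⟨hxK, ?_⟩
      rw [Finset.set_biInter_insert]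
      exact ⟨hxq, hxT⟩
  obtain ⟨x, hxK, hx⟩ := hKc.inter_iInter_nonempty
    (fun q : ↥(S i ∩ {q | k ≤ q.1}) => waveSet (e q)) (fun q => isClosed_waveSet _) fun u => by
      have h := hgood (u.map (Function.Embedding.subtype _)) (by
        intro q hq
        obtain ⟨q', -, rfl⟩ := Finset.mem_map.1 (Finset.mem_coe.1 hq)
        exact q'.2)
      obtain ⟨x, hxK, hx⟩ := nonempty_of_measure_ne_zero ((ms _).2.1.trans_le h).ne'
      refine ⟨x, hxK, Set.mem_iInter₂.2 fun q hq => ?_⟩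
      exact Set.mem_iInter₂.1 hx q (Finset.mem_map_of_mem _ hq)
  have hxE : x ∈ E i k := ⟨Set.Ico_subset_Icc_self (hK hxK).1, hx⟩
  exact (hK hxK).2 (subset_toMeasurable _ _ (Set.mem_iUnion₂.2 ⟨i, k, hxE⟩))

/-- Under the same hypothesis, `I`-many functions do not dominate: some increasing sequence outruns
each of them infinitely often. -/
lemma exists_strictMono_frequently_le {I : Type}
    (hnull : ∀ E : I → ℕ → Set ℝ, (∀ i k, IsCompact (E i k)) → (∀ i k, volume (E i k) = 0) →
      volume (⋃ i, ⋃ k, E i k) = 0) (φ : I → ℕ → ℕ) :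
    ∃ μ : ℕ → ℕ, StrictMono μ ∧ ∀ i k₀, ∃ k ≥ k₀, φ i (μ k) ≤ μ (k + 1) := by
  classical
  obtain ⟨N, hN⟩ := exists_predictor
  let ψ : I → ℕ → ℕ := fun i t => t + 1 + ∑ s ∈ Finset.range (t + 1), φ i s
  have hψφ : ∀ i t, φ i t ≤ ψ i t := fun i t =>
    (Finset.single_le_sum (f := φ i) (fun _ _ => Nat.zero_le _) (Finset.self_mem_range_succ t)).trans
      (Nat.le_add_left _ _)
  have hψlt : ∀ i t, t < ψ i t := fun i t => by simp only [ψ]; omega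
  have hψm : ∀ i, Monotone (ψ i) := fun i s t hst => by
    have : ∑ r ∈ Finset.range (s + 1), φ i r ≤ ∑ r ∈ Finset.range (t + 1), φ i r :=
      Finset.sum_le_sum_of_subset (Finset.range_mono (by omega))
    simp only [ψ]; omega
  let σ : I → ℕ → ℕ := fun i r => (fun t => ψ i (ψ i t))^[r] 0
  have hσ : ∀ i r, σ i (r + 1) = ψ i (ψ i (σ i r)) := fun i r =>
    Function.iterate_succ_apply' _ _ _
  have hσm : ∀ i, StrictMono (σ i) := fun i => strictMono_nat_of_lt_succ fun r => by
    rw [hσ]; exact (hψlt i _).trans (hψlt i _)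
  let S : I → Set (ℕ × ℕ) := fun i => Set.range fun r => (σ i r, 0)
  obtain ⟨B, -, hB⟩ := hN hnull S fun i k => by
    refine Set.Infinite.of_image Prod.fst (Set.infinite_of_forall_exists_gt fun a => ?_)
    refine ⟨σ i (a + k + 1), ⟨(σ i (a + k + 1), 0), ⟨⟨_, rfl⟩, ?_⟩, rfl⟩, ?_⟩
    · have := (hσm i).le_apply (x := a + k + 1)
      change k ≤ σ i (a + k + 1)
      omega
    · have := (hσm i).le_apply (x := a + k + 1)
      omega
  let box : ℕ → Finset (Finset (ℕ × ℕ)) := fun n => (Finset.range (n + 1) ×ˢ {0}).powerset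
  let h : ℕ → ℕ := fun n => n + 1 + ∑ T ∈ box n, ∑ q ∈ B T, q.1
  have hlt : ∀ n, n < h n := fun n => by simp only [h]; omega
  have hm : Monotone h := fun m n hmn => by
    have : ∑ T ∈ box m, ∑ q ∈ B T, q.1 ≤ ∑ T ∈ box n, ∑ q ∈ B T, q.1 := by
      refine Finset.sum_le_sum_of_subset (Finset.powerset_mono.2 ?_)
      exact Finset.product_subset_product_left (Finset.range_mono (by omega))
    simp only [h]; omega
  have hle : ∀ n, ∀ T ∈ box n, ∀ q ∈ B T, q.1 ≤ h n := fun n T hT q hq =>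
    calc q.1 ≤ ∑ q ∈ B T, q.1 := Finset.single_le_sum (f := fun q : ℕ × ℕ => q.1) (by simp) hq
      _ ≤ ∑ T ∈ box n, ∑ q ∈ B T, q.1 :=
        Finset.single_le_sum (f := fun T => ∑ q ∈ B T, q.1) (by simp) hT
      _ ≤ h n := Nat.le_add_left _ _
  have hbox : ∀ i n, ∀ T : Finset (ℕ × ℕ), ↑T ⊆ S i → (∀ t ∈ T, t.1 ≤ n) → T ∈ box n := by
    intro i n T hTS hT
    refine Finset.mem_powerset.2 fun t ht => ?_
    obtain ⟨r, hr⟩ := hTS ht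
    rw [Finset.mem_product, Finset.mem_range, Finset.mem_singleton]
    exact ⟨Nat.lt_succ_of_le (hT t ht), by rw [← hr]⟩
  have hgood : ∀ i n, ∃ t > n, ψ i (ψ i t) ≤ h t := by
    intro i n
    obtain ⟨T, q, hTS, hqS, hqT, hmax, hk, hqB⟩ := hB i (h n + 1)
    have hex : ∃ t ∈ T, n < t.1 := by
      by_contra! hcon
      have := hle n T (hbox i n T hTS hcon) q hqB
      omega
    obtain ⟨t₀, ht₀, hnt₀⟩ := hex
    obtain ⟨t, ht, htmax⟩ := T.exists_max_image Prod.fst ⟨t₀, ht₀⟩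
    refine ⟨t.1, hnt₀.trans_le (htmax t₀ ht₀), ?_⟩
    have hqle : q.1 ≤ h t.1 := hle _ T (hbox i _ T hTS htmax) q hqB
    obtain ⟨r, rfl⟩ := hTS ht
    obtain ⟨s, rfl⟩ := hqS
    have hrs : r < s := by
      rcases ((hσm i).le_iff_le.1 (hmax _ ht)).lt_or_eq with h | rfl
      · exact h
      · exact absurd ht hqT
    have := (hσm i).monotone (Nat.succ_le_of_lt hrs)
    rw [Nat.succ_eq_add_one, hσ] at this
    exact this.trans hqle
  let μ : ℕ → ℕ := fun k => h^[k] 0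
  have hμ : ∀ k, μ (k + 1) = h (μ k) := fun k => Function.iterate_succ_apply' _ _ _
  have hμm : StrictMono μ := strictMono_nat_of_lt_succ fun k => by rw [hμ]; exact hlt _
  refine ⟨μ, hμm, fun i k₀ => ?_⟩
  obtain ⟨t, ht, hψt⟩ := hgood i (μ k₀)
  have hex : ∃ k, t < μ k := ⟨t + 1, (Nat.lt_succ_self t).trans_le hμm.le_apply⟩
  obtain ⟨k, hk⟩ : ∃ k, Nat.find hex = k + 1 := by
    refine Nat.exists_eq_succ_of_ne_zero fun h0 => ?_
    have := Nat.find_spec hex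
    rw [h0] at this
    simp [μ] at this
  have h1 : t < μ (k + 1) := hk ▸ Nat.find_spec hex
  have h2 : μ k ≤ t := not_lt.1 (Nat.find_min hex (by omega))
  have hkk : k₀ ≤ k := Nat.lt_succ_iff.1 (hμm.lt_iff_lt.1 (ht.trans h1))
  by_cases hc : ψ i t ≤ μ (k + 1)
  · exact ⟨k, hkk, (hψφ i _).trans ((hψm i h2).trans hc)⟩
  · refine ⟨k + 1, by omega, (hψφ i _).trans ((hψm i (not_le.1 hc).le).trans (hψt.trans ?_))⟩
    rw [hμ (k + 1)]
    exact hm h1.le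

/-- Every subinterval of `[0, 1]` of length `2⁻ᵖ` has a subinterval of length `2⁻ᵇ` inside `Y`. -/
def ShrinksInto (Y : Set ℝ) (p b : ℕ) : Prop :=
  ∀ a : ℝ, 0 ≤ a → a + (1 / 2) ^ p ≤ 1 →
    ∃ c, a ≤ c ∧ c + (1 / 2) ^ b ≤ a + (1 / 2) ^ p ∧ Set.Icc c (c + (1 / 2) ^ b) ⊆ Y

/-- Between the scales `p` and `P` one can shrink into `Y` at least `n` times in a row. -/
def HasRoom (Y : Set ℝ) : ℕ → ℕ → ℕ → Prop
  | 0, p, P => p ≤ P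
  | n + 1, p, P => ∃ b, ShrinksInto Y p b ∧ HasRoom Y n b P

lemma ShrinksInto.mono_set {Y Y' : Set ℝ} {p b : ℕ} (h : ShrinksInto Y p b) (hY : Y ⊆ Y') :
    ShrinksInto Y' p b := fun a h0 h1 =>
  let ⟨c, hc, hc', hcY⟩ := h a h0 h1
  ⟨c, hc, hc', hcY.trans hY⟩

lemma half_pow_le_half_pow {p q : ℕ} (h : p ≤ q) : (1 / 2 : ℝ) ^ q ≤ (1 / 2) ^ p :=
  pow_le_pow_of_le_one (by norm_num) (by norm_num) h

lemma ShrinksInto.mono_left {Y : Set ℝ} {p p' b : ℕ} (h : ShrinksInto Y p b) (hp : p' ≤ p) :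
    ShrinksInto Y p' b := by
  intro a h0 h1
  have := half_pow_le_half_pow hp
  obtain ⟨c, hc, hc', hcY⟩ := h a h0 (by linarith)
  exact ⟨c, hc, by linarith, hcY⟩

lemma ShrinksInto.le {Y : Set ℝ} {p b : ℕ} (h : ShrinksInto Y p b) : p ≤ b := by
  obtain ⟨c, hc, hc', -⟩ := h 0 le_rfl (by
    rw [zero_add]; exact pow_le_one₀ (by norm_num) (by norm_num))
  have : (1 / 2 : ℝ) ^ b ≤ (1 / 2) ^ p := by linarith
  exact (pow_le_pow_iff_right_of_lt_one₀ (by norm_num) (by norm_num)).1 this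

lemma HasRoom.mono_set {Y Y' : Set ℝ} (hY : Y ⊆ Y') {n : ℕ} :
    ∀ {p P : ℕ}, HasRoom Y n p P → HasRoom Y' n p P := by
  induction n with
  | zero => exact fun h => h
  | succ n ih => exact fun ⟨b, hb, h⟩ => ⟨b, hb.mono_set hY, ih h⟩

lemma HasRoom.mono_left {Y : Set ℝ} {n p p' P : ℕ} (h : HasRoom Y n p P) (hp : p' ≤ p) :
    HasRoom Y n p' P := by
  cases n with
  | zero => exact hp.trans h
  | succ n => exact let ⟨b, hb, h⟩ := h; ⟨b, hb.mono_left hp, h⟩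

lemma HasRoom.mono_right {Y : Set ℝ} {P P' : ℕ} (hP : P ≤ P') {n : ℕ} :
    ∀ {p : ℕ}, HasRoom Y n p P → HasRoom Y n p P' := by
  induction n with
  | zero => exact fun h => le_trans h hP
  | succ n ih => exact fun ⟨b, hb, h⟩ => ⟨b, hb, ih h⟩

lemma HasRoom.le {Y : Set ℝ} {P : ℕ} {n : ℕ} : ∀ {p : ℕ}, HasRoom Y n p P → p ≤ P := by
  induction n with
  | zero => exact fun h => h
  | succ n ih => exact fun ⟨b, hb, h⟩ => hb.le.trans (ih h)

/-- If each of at most `n` sets has room for `n` shrinkings between the scales `p` and `P`, then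
one can shrink from scale `p` to scale `P` into all of them at once. -/
lemma exists_Icc_subset_of_hasRoom {α : Type*} {Y : α → Set ℝ} {P : ℕ} (n : ℕ) :
    ∀ (G : Finset α) (p : ℕ), G.card ≤ n → (∀ v ∈ G, HasRoom (Y v) n p P) → p ≤ P →
      ∀ a : ℝ, 0 ≤ a → a + (1 / 2) ^ p ≤ 1 →
        ∃ c, a ≤ c ∧ c + (1 / 2) ^ P ≤ a + (1 / 2) ^ p ∧
          ∀ v ∈ G, Set.Icc c (c + (1 / 2) ^ P) ⊆ Y v := by
  classical
  induction n with
  | zero =>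
    intro G p hG _ hp a h0 h1
    rw [Nat.le_zero, Finset.card_eq_zero] at hG
    subst hG
    exact ⟨a, le_rfl, by linarith [half_pow_le_half_pow hp], by simp⟩
  | succ n ih =>
    intro G p hG hroom hp a h0 h1
    rcases G.eq_empty_or_nonempty with rfl | ⟨w, hw⟩
    · exact ⟨a, le_rfl, by linarith [half_pow_le_half_pow hp], by simp⟩
    have hex : ∃ b, ∃ v ∈ G, ShrinksInto (Y v) p b := by
      obtain ⟨b, hb, -⟩ := hroom w hw
      exact ⟨b, w, hw, hb⟩
    obtain ⟨v, hv, hvb⟩ := Nat.find_spec hex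
    set b := Nat.find hex
    have hrest : ∀ u ∈ G, HasRoom (Y u) n b P := by
      intro u hu
      obtain ⟨b', hb', h⟩ := hroom u hu
      exact h.mono_left (Nat.find_min' hex ⟨u, hu, hb'⟩)
    obtain ⟨c, hac, hca, hcY⟩ := hvb a h0 h1
    obtain ⟨d, hcd, hdc, hdY⟩ := ih (G.erase v) b (by rw [Finset.card_erase_of_mem hv]; omega)
      (fun u hu => hrest u (Finset.mem_of_mem_erase hu)) (hrest v hv).le c (h0.trans hac)
      (hca.trans h1)
    refine ⟨d, hac.trans hcd, hdc.trans hca, fun u hu => ?_⟩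
    by_cases huv : u = v
    · subst huv
      exact (Set.Icc_subset_Icc hcd hdc).trans hcY
    · exact hdY u (Finset.mem_erase.2 ⟨huv, hu⟩)

/-- The union of finitely many closed intervals with rational endpoints. -/
def ratIccUnion (v : Finset (ℚ × ℚ)) : Set ℝ := ⋃ q ∈ v, Set.Icc (q.1 : ℝ) q.2

lemma ratIccUnion_mono {v w : Finset (ℚ × ℚ)} (h : v ⊆ w) : ratIccUnion v ⊆ ratIccUnion w :=
  Set.biUnion_subset_biUnion_left h

lemma exists_shrinksInto_disjoint {C : Set ℝ} (hC : IsClosed C) (hC' : interior C = ∅) (p : ℕ) :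
    ∃ (v : Finset (ℚ × ℚ)) (b : ℕ), Disjoint (ratIccUnion v) C ∧ ShrinksInto (ratIccUnion v) p b := by
  classical
  have hp : (0 : ℝ) < 2 ^ (p + 1) := by positivity
  have key : ∀ j : ℕ, ∃ q : ℚ × ℚ, (q.1 : ℝ) < q.2 ∧
      Set.Icc (q.1 : ℝ) q.2 ⊆ Set.Ioo ((j : ℝ) / 2 ^ (p + 1)) ((j + 1) / 2 ^ (p + 1)) \ C := by
    intro j
    set O := Set.Ioo ((j : ℝ) / 2 ^ (p + 1)) ((j + 1) / 2 ^ (p + 1))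
    have hO : O.Nonempty := Set.nonempty_Ioo.2 (by gcongr; linarith)
    obtain ⟨x, hxO, hxC⟩ : ∃ x ∈ O, x ∉ C := by
      by_contra! h
      have h' : O ⊆ interior C := interior_maximal h isOpen_Ioo
      rw [hC'] at h'
      exact hO.ne_empty (Set.subset_empty_iff.1 h')
    obtain ⟨ε, hε, hball⟩ := Metric.isOpen_iff.1 (isOpen_Ioo.sdiff hC) x ⟨hxO, hxC⟩
    obtain ⟨r, hr1, hr2⟩ := exists_rat_btwn (show x - ε < x by linarith)
    obtain ⟨s, hs1, hs2⟩ := exists_rat_btwn (show x < x + ε by linarith)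
    refine ⟨(r, s), hr2.trans hs1, fun y hy => hball ?_⟩
    have h1 : (r : ℝ) ≤ y := hy.1
    have h2 : y ≤ (s : ℝ) := hy.2
    rw [Metric.mem_ball, Real.dist_eq, abs_lt]
    constructor <;> linarith
  choose q hq hqs using key
  choose b hb using fun j => exists_pow_lt_of_lt_one (sub_pos.2 (hq j)) (by norm_num : (1 / 2 : ℝ) < 1)
  refine ⟨(Finset.range (2 ^ (p + 1))).image q, (Finset.range (2 ^ (p + 1))).sup b, ?_, ?_⟩
  · rw [Set.disjoint_left]
    intro x hx hxC
    obtain ⟨r, hr, hxr⟩ := Set.mem_iUnion₂.1 hx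
    obtain ⟨j, -, rfl⟩ := Finset.mem_image.1 hr
    exact (hqs j hxr).2 hxC
  · intro a h0 h1
    set j := ⌈a * 2 ^ (p + 1)⌉₊
    have hj1 : a * 2 ^ (p + 1) ≤ j := Nat.le_ceil _
    have hj2 : (j : ℝ) < a * 2 ^ (p + 1) + 1 := Nat.ceil_lt_add_one (by positivity)
    have hpow : (1 / 2 : ℝ) ^ p * 2 ^ (p + 1) = 2 := by
      rw [pow_succ, ← mul_assoc, ← mul_pow]; norm_num
    have hjr : j ∈ Finset.range (2 ^ (p + 1)) := by
      rw [Finset.mem_range]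
      have : (j : ℝ) < 2 ^ (p + 1) := by nlinarith
      exact_mod_cast this
    have hbj := half_pow_le_half_pow (Finset.le_sup (f := b) hjr)
    have hl := (hqs j (Set.left_mem_Icc.2 (hq j).le)).1.1
    have hr := (hqs j (Set.right_mem_Icc.2 (hq j).le)).1.2
    rw [div_lt_iff₀ hp] at hl
    rw [lt_div_iff₀ hp] at hr
    have hbj' := hb j
    refine ⟨(q j).1, ?_, ?_, ?_⟩
    · by_contra hcon
      nlinarith
    · have : ((q j).2 : ℝ) ≤ a + (1 / 2) ^ p := by
        by_contra hcon
        nlinarith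
      linarith
    · refine subset_trans (Set.Icc_subset_Icc_right (by linarith)) ?_
      exact Set.subset_biUnion_of_mem (u := fun q : ℚ × ℚ => Set.Icc (q.1 : ℝ) q.2)
        (Finset.mem_coe.2 (Finset.mem_image_of_mem q hjr))

lemma exists_hasRoom_disjoint {C : Set ℝ} (hC : IsClosed C) (hC' : interior C = ∅) (n : ℕ) :
    ∀ p : ℕ, ∃ (v : Finset (ℚ × ℚ)) (P : ℕ), Disjoint (ratIccUnion v) C ∧
      HasRoom (ratIccUnion v) n p P := by
  classical
  induction n with
  | zero => exact fun p => ⟨∅, p, by simp [ratIccUnion], le_rfl⟩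
  | succ n ih =>
    intro p
    obtain ⟨v, b, hv, hb⟩ := exists_shrinksInto_disjoint hC hC' p
    obtain ⟨w, P, hw, hP⟩ := ih b
    refine ⟨v ∪ w, P, ?_, b, hb.mono_set (ratIccUnion_mono Finset.subset_union_left),
      hP.mono_set (ratIccUnion_mono Finset.subset_union_right)⟩
    have : ratIccUnion (v ∪ w) = ratIccUnion v ∪ ratIccUnion w := Finset.set_biUnion_union _ _ _
    rw [this]
    exact hv.union_left hw

/-- A meagre set is covered by an increasing sequence of closed sets with empty interior. -/
lemma IsMeagre.exists_monotone_closed_cover {M : Set ℝ} (hM : IsMeagre M) :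
    ∃ C : ℕ → Set ℝ, Monotone C ∧ (∀ n, IsClosed (C n)) ∧ (∀ n, interior (C n) = ∅) ∧
      M ⊆ ⋃ n, C n := by
  obtain ⟨S, hS, hSc, hMS⟩ := isMeagre_iff_countable_union_isNowhereDense.1 hM
  obtain ⟨f, hf⟩ := (hSc.insert ∅).exists_eq_range (Set.insert_nonempty _ _)
  have hfn : ∀ n, interior (closure (f n)) = ∅ := by
    intro n
    rcases (hf ▸ Set.mem_range_self n : f n ∈ insert ∅ S) with h | h
    · simp [h]
    · exact hS _ h
  have hcl : ∀ n, IsClosed (Set.accumulate (fun n => closure (f n)) n) := fun n =>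
    (Set.finite_Iic n).isClosed_biUnion fun _ _ => isClosed_closure
  refine ⟨Set.accumulate fun n => closure (f n), Set.monotone_accumulate, hcl, fun n => ?_, ?_⟩
  · induction n with
    | zero => simp [Set.accumulate_def, hfn]
    | succ n ih =>
      rw [Set.accumulate_succ, interior_union_isClosed_of_interior_empty (hcl n) (hfn _), ih]
  · rw [Set.iUnion_accumulate]
    intro x hx
    obtain ⟨s, hs, hxs⟩ := hMS hx
    obtain ⟨n, rfl⟩ : s ∈ Set.range f := hf ▸ Set.mem_insert_of_mem _ hs
    exact Set.mem_iUnion.2 ⟨n, subset_closure hxs⟩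

/-- If `I`-many compact null sets always have a null union, then `I`-many meagre sets do not cover
the line. -/
lemma exists_notMem_of_isMeagre {I : Type}
    (hnull : ∀ E : I → ℕ → Set ℝ, (∀ i k, IsCompact (E i k)) → (∀ i k, volume (E i k) = 0) →
      volume (⋃ i, ⋃ k, E i k) = 0) (M : I → Set ℝ) (hM : ∀ i, IsMeagre (M i)) :
    ∃ y, ∀ i, y ∉ M i := by
  classical
  choose C hCm hCc hCi hMC using fun i => (hM i).exists_monotone_closed_cover
  obtain ⟨N, hN⟩ := exists_predictor
  let box : ℕ → Finset (Finset (ℕ × ℕ)) := fun t =>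
    (Finset.range (t + 1) ×ˢ Finset.range (t + 1)).powerset
  let W : ℕ → ℕ := fun t => ∑ T ∈ box t, N T.card
  choose v P hvC hvP using fun i t => exists_hasRoom_disjoint (hCc i t) (hCi i t) (W t) t
  obtain ⟨μ, hμm, hμ⟩ := exists_strictMono_frequently_le hnull
    fun i t => max (Encodable.encode (v i t)) (P i t)
  let S : I → Set (ℕ × ℕ) := fun i => {q | q.2 = Encodable.encode (v i (μ q.1)) ∧
    max (Encodable.encode (v i (μ q.1))) (P i (μ q.1)) ≤ μ (q.1 + 1)}
  obtain ⟨B, hBc, hB⟩ := hN hnull S fun i k => by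
    refine Set.Infinite.of_image Prod.fst (Set.infinite_of_forall_exists_gt fun a => ?_)
    obtain ⟨l, hl, hle⟩ := hμ i (a + k + 1)
    refine ⟨l, ⟨(l, Encodable.encode (v i (μ l))), ⟨⟨rfl, hle⟩, ?_⟩, rfl⟩, by omega⟩
    change k ≤ l
    omega
  let Y : ℕ → Set ℝ := fun c => ratIccUnion ((Encodable.decode c).getD ∅)
  have hY : ∀ w, Y (Encodable.encode w) = ratIccUnion w := fun w => by simp [Y]
  let G : ℕ → Finset ℕ := fun k => (Finset.range (μ (k + 1) + 1)).filter fun c =>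
    HasRoom (Y c) (W (μ k)) (μ k) (μ (k + 1)) ∧ ∃ T ∈ box (μ k), (k, c) ∈ B T
  have hG : ∀ k, (G k).card ≤ W (μ k) := by
    intro k
    have hsub : G k ⊆ (box (μ k)).biUnion fun T => (B T).image Prod.snd := by
      intro c hc
      obtain ⟨-, -, T, hT, hcT⟩ := Finset.mem_filter.1 hc
      exact Finset.mem_biUnion.2 ⟨T, hT, Finset.mem_image.2 ⟨(k, c), hcT, rfl⟩⟩
    refine (Finset.card_le_card hsub).trans (Finset.card_biUnion_le.trans ?_)
    exact Finset.sum_le_sum fun T _ => Finset.card_image_le.trans (hBc T)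
  have hstep : ∀ (k : ℕ) (a : {a : ℝ // 0 ≤ a ∧ a + (1 / 2) ^ μ k ≤ 1}),
      ∃ c : {a : ℝ // 0 ≤ a ∧ a + (1 / 2) ^ μ (k + 1) ≤ 1},
        a.1 ≤ c.1 ∧ c.1 + (1 / 2) ^ μ (k + 1) ≤ a.1 + (1 / 2) ^ μ k ∧
          ∀ l ∈ G k, Set.Icc c.1 (c.1 + (1 / 2) ^ μ (k + 1)) ⊆ Y l := by
    rintro k ⟨a, h0, h1⟩
    obtain ⟨c, h2, h3, h4⟩ := exists_Icc_subset_of_hasRoom (Y := Y) (W (μ k)) (G k) (μ k) (hG k)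
      (fun c hc => (Finset.mem_filter.1 hc).2.1) (hμm (Nat.lt_succ_self k)).le a h0 h1
    exact ⟨⟨c, h0.trans h2, h3.trans h1⟩, h2, h3, h4⟩
  choose nxt hn1 hn2 hn3 using hstep
  let a : (k : ℕ) → {a : ℝ // 0 ≤ a ∧ a + (1 / 2) ^ μ k ≤ 1} := fun k =>
    Nat.rec ⟨0, le_rfl, by rw [zero_add]; exact pow_le_one₀ (by norm_num) (by norm_num)⟩ nxt k
  let J : ℕ → Set ℝ := fun k => Set.Icc (a k).1 ((a k).1 + (1 / 2) ^ μ k)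
  obtain ⟨y, hy⟩ := IsCompact.nonempty_iInter_of_sequence_nonempty_isCompact_isClosed J
    (fun k => Set.Icc_subset_Icc (hn1 k (a k)) (hn2 k (a k)))
    (fun k => Set.nonempty_Icc.2 (le_add_of_nonneg_right (by positivity))) isCompact_Icc
    (fun k => isClosed_Icc)
  rw [Set.mem_iInter] at hy
  refine ⟨y, fun i hyM => ?_⟩
  obtain ⟨n, hn⟩ := Set.mem_iUnion.1 (hMC i hyM)
  obtain ⟨T, ⟨k, c⟩, hTS, ⟨hc, hmax⟩, hqT, hTk, hnk, hcB⟩ := hB i n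
  dsimp only at hc hmax hTk hnk
  have hbox : T ∈ box (μ k) := by
    refine Finset.mem_powerset.2 fun t ht => ?_
    obtain ⟨ht2, htmax⟩ := hTS ht
    have hlt : t.1 < k := by
      refine (hTk t ht).lt_of_ne fun h => hqT ?_
      have : t = (k, c) := Prod.ext h (by rw [ht2, h, hc])
      rwa [← this]
    have h1 : μ (t.1 + 1) ≤ μ k := hμm.monotone hlt
    have h2 : t.2 ≤ μ (t.1 + 1) := ht2 ▸ (le_max_left _ _).trans htmax
    have h3 : t.1 < μ k := hlt.trans_le hμm.le_apply
    rw [Finset.mem_product, Finset.mem_range, Finset.mem_range]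
    omega
  have hcG : c ∈ G k := by
    refine Finset.mem_filter.2 ⟨?_, ?_, T, hbox, hcB⟩
    · rw [Finset.mem_range, hc]
      exact Nat.lt_succ_of_le ((le_max_left _ _).trans hmax)
    · rw [hc, hY]
      exact (hvP i (μ k)).mono_right ((le_max_right _ _).trans hmax)
  have hyY : y ∈ ratIccUnion (v i (μ k)) := by
    rw [← hY, ← hc]
    exact hn3 k (a k) c hcG (hy (k + 1))
  exact Set.disjoint_left.1 (hvC i (μ k)) hyY (hCm i (hnk.trans hμm.le_apply) hn)

/-- **GP(all) implies cov(M) ≠ 𝔟**. -/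
theorem gp_all_implies_covMeagre_ne_boundingNumber
    (hGP : ∀ A : (ℕ → ℕ) → Set ℝ,
      (∀ x, volume (A x) = 0) →
      (∀ x x' : ℕ → ℕ, (∀ n, x n ≤ x' n) → A x ⊆ A x') →
      volume (⋃ x : ℕ → ℕ, A x) = 0) :
    covMeagre ≠ boundingNumber := by
  intro hcb
  obtain ⟨F, hF, hmeagre, hcover⟩ := exists_cover_mk_eq_covMeagre
  obtain ⟨y, hy⟩ := exists_notMem_of_isMeagre (I := F) (volume_iUnion_compact_null_of_gp hGP hcb hF)
    (fun s => s) fun s => hmeagre s s.2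
  obtain ⟨s, hs, hys⟩ : y ∈ ⋃₀ F := hcover ▸ Set.mem_univ y
  exact hy ⟨s, hs⟩ hys
end

section
/- Work in the Cantor space 2^ω = ℕ → ZMod 2 equipped with its Haar probability measure μ (the fair coin-flipping product measure). Let (C_n)_{n ∈ ℕ} be a sequence of clopen subsets of 2^ω with μ(C_n) ≤ 2^{-n} for every n. For a strictly increasing function s : ℕ → ℕ with s(0) = 0 (coding the interval partition with blocks J_m = [s(m), s(m+1))), define E_s = { x ∈ 2^ω : for all but finitely many m, there exists n with s(m) ≤ n < s(m+1) and x ∈ C_n }. Then: (i) if s, t code interval partitions such that for all but finitely many k some block of s is contained in the block [t(k), t(k+1)) of t, then E_s ⊆ E_t; (ii) each E_s is a countable union of closed μ-null sets; (iii) { x ∈ 2^ω : x ∈ C_n for infinitely many n } ⊆ ⋃_s E_s, the union taken over all strictly increasing s : ℕ → ℕ with s(0) = 0. -/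
open MeasureTheory Filter
open scoped ENNReal

/-- The Cantor group `2^ω = ℕ → ZMod 2`. -/
abbrev Cantor : Type := ℕ → ZMod 2

/-- Given clopen sets `C n` and an interval partition coded by `s` (strictly increasing,
`s 0 = 0`, with blocks `[s m, s (m+1))`), the set
`E_s = { x : for all but finitely many m, x ∈ C n for some n in the m-th block }`. -/
def Eset (C : ℕ → Set Cantor) (s : ℕ → ℕ) : Set Cantor :=
  {x | ∀ᶠ m in atTop, ∃ n, s m ≤ n ∧ n < s (m + 1) ∧ x ∈ C n}

/-- Every point of `E_s` lies in infinitely many of the sets `C n`. -/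
theorem Eset_subset_setOf_frequently (C : ℕ → Set Cantor) {s : ℕ → ℕ} (hs : StrictMono s) :
    Eset C s ⊆ {x | ∃ᶠ n in atTop, x ∈ C n} := by
  intro x hx
  obtain ⟨M, hM⟩ := eventually_atTop.1 hx
  refine frequently_atTop.2 fun a => ?_
  obtain ⟨n, hn, -, hxn⟩ := hM (max M a) (le_max_left _ _)
  exact ⟨n, ((le_max_right M a).trans (hs.id_le _)).trans hn, hxn⟩

/-- `E_s` is monotone in the interval partition order. -/
theorem Eset_subset_Eset (C : ℕ → Set Cantor) {s t : ℕ → ℕ} (hs : StrictMono s)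
    (ht : StrictMono t) (hst : ∀ᶠ k in atTop, ∃ m, t k ≤ s m ∧ s (m + 1) ≤ t (k + 1)) :
    Eset C s ⊆ Eset C t := by
  intro x hx
  obtain ⟨M, hM⟩ := eventually_atTop.1 hx
  filter_upwards [hst, eventually_ge_atTop (s M)] with k ⟨m, htm, hmt⟩ hk
  have hMm : M ≤ m := hs.le_iff_le.1 ((hk.trans (ht.id_le k)).trans htm)
  obtain ⟨n, hn, hn', hxn⟩ := hM m hMm
  exact ⟨n, htm.trans hn, hn'.trans_le hmt, hxn⟩

/-- `E_s` is the increasing union over `M` of the sets of points that meet every block from the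
`M`-th on. -/
theorem Eset_eq_iUnion (C : ℕ → Set Cantor) (s : ℕ → ℕ) :
    Eset C s = ⋃ M, ⋂ m ≥ M, ⋃ n ∈ Set.Ico (s m) (s (m + 1)), C n := by
  ext x
  simp [Eset, and_assoc]

/-- If the measures of the sets `C n` are summable, then `E_s` is null. -/
theorem measure_Eset_eq_zero {μ : Measure Cantor} {C : ℕ → Set Cantor} (hC : ∑' n, μ (C n) ≠ ∞)
    {s : ℕ → ℕ} (hs : StrictMono s) : μ (Eset C s) = 0 :=
  measure_mono_null (Eset_subset_setOf_frequently C hs) (measure_setOfPred_frequently_eq_zero hC)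

/-- A point lying in infinitely many of the sets `C n` lies in some `E_s`. -/
theorem exists_mem_Eset_of_frequently {C : ℕ → Set Cantor} {x : Cantor}
    (hx : ∃ᶠ n in atTop, x ∈ C n) : ∃ s : ℕ → ℕ, (StrictMono s ∧ s 0 = 0) ∧ x ∈ Eset C s := by
  obtain ⟨φ, hφ, hxφ⟩ := extraction_of_frequently_atTop hx
  let s : ℕ → ℕ := fun m => Nat.casesOn m 0 fun k => φ k + 1
  have hs : ∀ m, s m ≤ φ m
    | 0 => Nat.zero_le _
    | k + 1 => hφ k.lt_succ_self
  exact ⟨s, ⟨strictMono_nat_of_lt_succ fun m => Nat.lt_succ_of_le (hs m), rfl⟩,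
    Eventually.of_forall fun m => ⟨φ m, hs m, Nat.lt_succ_self _, hxφ m⟩⟩

/-- For a sequence of clopen sets `C n` with `μ (C n) ≤ 2⁻ⁿ` in the Cantor group with its
Haar probability measure: (i) `E_s` is monotone in the interval partition order;
(ii) each `E_s` is a countable union of closed null sets;
(iii) `limsup C n ⊆ ⋃_s E_s`. -/
theorem Eset_monotone_null_and_covers
    (μ : Measure Cantor) [μ.IsAddHaarMeasure] [IsProbabilityMeasure μ]
    (C : ℕ → Set Cantor) (hC : ∀ n, IsClopen (C n))
    (hμC : ∀ n, μ (C n) ≤ (2 : ℝ≥0∞)⁻¹ ^ n) :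
    (∀ s t : ℕ → ℕ, StrictMono s → s 0 = 0 → StrictMono t → t 0 = 0 →
      (∀ᶠ k in atTop, ∃ m, t k ≤ s m ∧ s (m + 1) ≤ t (k + 1)) →
      Eset C s ⊆ Eset C t) ∧
    (∀ s : ℕ → ℕ, StrictMono s → s 0 = 0 →
      ∃ D : ℕ → Set Cantor, (∀ n, IsClosed (D n) ∧ μ (D n) = 0) ∧
        Eset C s = ⋃ n, D n) ∧
    ({x : Cantor | ∃ᶠ n in atTop, x ∈ C n} ⊆
      ⋃ s : {s : ℕ → ℕ // StrictMono s ∧ s 0 = 0}, Eset C s.1) := by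
  refine ⟨fun s t hs _ ht _ hst => Eset_subset_Eset C hs ht hst, fun s hs _ => ?_, fun x hx => ?_⟩
  · refine ⟨_, fun M => ⟨?_, ?_⟩, Eset_eq_iUnion C s⟩
    · exact isClosed_biInter fun m _ =>
        (Set.finite_Ico _ _).isClosed_biUnion fun n _ => (hC n).isClosed
    · have hsum : ∑' n, μ (C n) ≠ ∞ := by
        refine ne_top_of_le_ne_top ?_ (ENNReal.tsum_le_tsum hμC)
        rw [ENNReal.tsum_geometric, ENNReal.one_sub_inv_two, inv_inv]
        exact ENNReal.ofNat_ne_top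
      refine measure_mono_null ?_ (measure_Eset_eq_zero hsum hs)
      rw [Eset_eq_iUnion]
      exact Set.subset_iUnion
        (fun M => ⋂ m ≥ M, ⋃ n ∈ Set.Ico (s m) (s (m + 1)), C n) M
  · obtain ⟨s, hs, hxs⟩ := exists_mem_Eset_of_frequently hx
    exact Set.mem_iUnion.2 ⟨⟨s, hs⟩, hxs⟩
end

section
/- Work in the Cantor space 2^ω = ℕ → ZMod 2 equipped with its Haar probability measure μ. For every μ-null set N ⊆ 2^ω there exists a family (E_s), indexed by strictly increasing functions s : ℕ → ℕ with s(0) = 0 (coding interval partitions of ℕ), such that: (i) each E_s is contained in a countable union of closed μ-null sets; (ii) the family is monotone with respect to the interval-partition order: s ⊏ t implies E_s ⊆ E_t; and (iii) N ⊆ ⋃_s E_s. -/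
open MeasureTheory Filter

open scoped ENNReal

/-- In a second countable space with a basis of clopen sets, every open set is a disjoint union
of a sequence of clopen sets. -/
theorem IsOpen.exists_disjoint_isClopen_iUnion_eq {X : Type*} [TopologicalSpace X]
    [SecondCountableTopology X]
    (hX : TopologicalSpace.IsTopologicalBasis {s : Set X | IsClopen s})
    {U : Set X} (hU : IsOpen U) :
    ∃ C : ℕ → Set X, (∀ n, IsClopen (C n)) ∧ Pairwise (Function.onFun Disjoint C) ∧
      ⋃ n, C n = U := by
  obtain ⟨S, hS, rfl⟩ := hX.open_eq_sUnion hU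
  obtain ⟨T, hTc, hTS, hT⟩ :=
    TopologicalSpace.isOpen_sUnion_countable S fun s hs => (hS hs).isOpen
  obtain ⟨f, hf⟩ := (hTc.insert ∅).exists_eq_range (Set.insert_nonempty _ _)
  have hclopen : ∀ n, IsClopen (f n) := by
    intro n
    have hn : f n ∈ insert ∅ T := hf ▸ Set.mem_range_self n
    rcases hn with hn | hn
    · rw [hn]
      exact isClopen_empty
    · exact hS (hTS hn)
  refine ⟨disjointed f, fun n => ?_, disjoint_disjointed f, ?_⟩
  · exact disjointedRec (p := IsClopen) (fun _ i ht => ht.diff (hclopen i)) (hclopen n)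
  · rw [iUnion_disjointed, ← Set.sUnion_range, ← hf, Set.sUnion_insert, Set.empty_union, hT]

/-- A null set in a zero-dimensional second countable space is contained in the limsup of a
sequence of clopen sets with summable measures. -/
theorem exists_isClopen_tsum_ne_top_frequently_mem {X : Type*} [TopologicalSpace X]
    [SecondCountableTopology X] [MeasurableSpace X] [OpensMeasurableSpace X]
    (hX : TopologicalSpace.IsTopologicalBasis {s : Set X | IsClopen s})
    (μ : Measure X) [μ.OuterRegular] {N : Set X} (hN : μ N = 0) :
    ∃ C : ℕ → Set X, (∀ n, IsClopen (C n)) ∧ ∑' n, μ (C n) ≠ ∞ ∧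
      ∀ x ∈ N, ∃ᶠ n in atTop, x ∈ C n := by
  obtain ⟨ε, hε, hεsum⟩ := ENNReal.exists_pos_sum_of_countable' one_ne_zero ℕ
  have hopen : ∀ j, ∃ U, N ⊆ U ∧ IsOpen U ∧ μ U < ε j := fun j => by
    obtain ⟨U, hNU, hU, h⟩ := N.exists_isOpen_lt_of_lt (μ := μ) (ε j) (hN ▸ hε j)
    exact ⟨U, hNU, hU, h⟩
  choose U hNU hU hUε using hopen
  choose D hDclopen hDdisj hDU using
    fun j => (hU j).exists_disjoint_isClopen_iUnion_eq hX
  refine ⟨fun n => D n.unpair.1 n.unpair.2, fun n => hDclopen _ _, ?_, fun x hx => ?_⟩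
  · have h : ∑' n : ℕ, μ (D n.unpair.1 n.unpair.2) = ∑' j, μ (U j) := by
      rw [← Nat.pairEquiv.tsum_eq, ENNReal.tsum_prod']
      refine tsum_congr fun j => ?_
      rw [← hDU j, measure_iUnion (hDdisj j) fun i => (hDclopen j i).isOpen.measurableSet]
      simp
    rw [h]
    exact ((ENNReal.tsum_le_tsum fun j => (hUε j).le).trans_lt
      (hεsum.trans ENNReal.one_lt_top)).ne
  · have hmem : ∀ j, ∃ i, x ∈ D j i := fun j => by
      rw [← Set.mem_iUnion, hDU j]
      exact hNU j hx
    refine frequently_atTop.2 fun a => ?_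
    obtain ⟨i, hi⟩ := hmem a
    exact ⟨Nat.pair a i, Nat.left_le_pair a i, by simpa using hi⟩

/-- If `p` holds infinitely often, there is an interval partition each of whose blocks contains
a point satisfying `p`. -/
theorem exists_strictMono_forall_exists_mem_block {p : ℕ → Prop} (hp : ∃ᶠ n in atTop, p n) :
    ∃ s : ℕ → ℕ, (StrictMono s ∧ s 0 = 0) ∧ ∀ k, ∃ n, s k ≤ n ∧ n < s (k + 1) ∧ p n := by
  choose f hf hpf using frequently_atTop.1 hp
  let s : ℕ → ℕ := fun k => Nat.rec 0 (fun _ a => f a + 1) k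
  have hs : ∀ k, s (k + 1) = f (s k) + 1 := fun _ => rfl
  refine ⟨s, ⟨strictMono_nat_of_lt_succ fun k => ?_, rfl⟩, fun k => ⟨f (s k), hf _, ?_, hpf _⟩⟩
  · rw [hs]
    exact Nat.lt_succ_of_le (hf _)
  · rw [hs]
    exact Nat.lt_succ_self _

/-- The points that, for all but finitely many `k`, belong to some `C n` with `n` in the `k`-th
block of `s`. -/
def eventuallyMeets {X : Type*} (C : ℕ → Set X) (s : ℕ → ℕ) : Set X :=
  {x | ∀ᶠ k in atTop, ∃ n, s k ≤ n ∧ n < s (k + 1) ∧ x ∈ C n}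

theorem eventuallyMeets_subset {X : Type*} (C : ℕ → Set X) {s t : ℕ → ℕ} (hs : StrictMono s)
    (ht : StrictMono t)
    (hst : ∀ᶠ k in atTop, ∃ m, t k ≤ s m ∧ s (m + 1) ≤ t (k + 1)) :
    eventuallyMeets C s ⊆ eventuallyMeets C t := by
  intro x hx
  obtain ⟨a, ha⟩ := eventually_atTop.1 hx
  filter_upwards [hst, eventually_ge_atTop (s a)] with k ⟨m, hm, hm'⟩ hk
  have ham : a ≤ m := hs.le_iff_le.1 ((hk.trans ht.le_apply).trans hm)
  obtain ⟨n, hn, hn', hxn⟩ := ha m ham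
  exact ⟨n, hm.trans hn, hn'.trans_le hm', hxn⟩

theorem exists_isClosed_null_eventuallyMeets_subset {X : Type*} [TopologicalSpace X]
    [MeasurableSpace X] (μ : Measure X) {C : ℕ → Set X} (hC : ∀ n, IsClosed (C n))
    (hsum : ∑' n, μ (C n) ≠ ∞) {s : ℕ → ℕ} (hs : StrictMono s) :
    ∃ D : ℕ → Set X, (∀ n, IsClosed (D n) ∧ μ (D n) = 0) ∧ eventuallyMeets C s ⊆ ⋃ n, D n := by
  let B : ℕ → Set X := fun k => ⋃ n ∈ Set.Ico (s k) (s (k + 1)), C n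
  refine ⟨fun a => ⋂ k ≥ a, B k, fun a => ⟨?_, ?_⟩, fun x hx => ?_⟩
  · exact isClosed_biInter fun k _ => (Set.finite_Ico _ _).isClosed_biUnion fun n _ => hC n
  · have hB : ∀ k, μ (B k) ≤ ∑' n, μ (C (n + s k)) := fun k => by
      refine (measure_mono ?_).trans (measure_iUnion_le _)
      refine Set.iUnion₂_subset fun n hn => ?_
      refine Set.subset_iUnion_of_subset (n - s k) ?_
      rw [Nat.sub_add_cancel hn.1]
    have hlim : Tendsto (fun k => ∑' n, μ (C (n + s k))) atTop (nhds 0) :=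
      (ENNReal.tendsto_sum_nat_add (fun n => μ (C n)) hsum).comp hs.tendsto_atTop
    refine le_antisymm (ge_of_tendsto hlim ?_) zero_le
    filter_upwards [eventually_ge_atTop a] with k hk
    exact (measure_mono (Set.biInter_subset_of_mem hk)).trans (hB k)
  · obtain ⟨a, ha⟩ := eventually_atTop.1 hx
    refine Set.mem_iUnion.2 ⟨a, Set.mem_iInter₂.2 fun k hk => ?_⟩
    obtain ⟨n, hn, hn', hxn⟩ := ha k hk
    exact Set.mem_biUnion (Set.mem_Ico.2 ⟨hn, hn'⟩) hxn

/-- For every null set `N` in the Cantor group with its Haar probability measure,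
there is a family `E_s`, indexed by interval partitions of `ℕ` (coded by strictly
increasing `s : ℕ → ℕ` with `s 0 = 0`, with blocks `[s m, s (m+1))`), such that:
(i) each `E_s` is contained in a countable union of closed null sets,
(ii) the family is monotone in the interval partition order `⊏`, and
(iii) `N ⊆ ⋃_s E_s`. -/
theorem null_set_covered_by_monotone_E_family
    (μ : Measure Cantor) [μ.IsAddHaarMeasure] [IsProbabilityMeasure μ]
    (N : Set Cantor) (hN : μ N = 0) :
    ∃ E : {s : ℕ → ℕ // StrictMono s ∧ s 0 = 0} → Set Cantor,
      (∀ s, ∃ D : ℕ → Set Cantor,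
        (∀ n, IsClosed (D n) ∧ μ (D n) = 0) ∧ E s ⊆ ⋃ n, D n) ∧
      (∀ s t : {s : ℕ → ℕ // StrictMono s ∧ s 0 = 0},
        (∀ᶠ k in atTop, ∃ m, t.1 k ≤ s.1 m ∧ s.1 (m + 1) ≤ t.1 (k + 1)) →
        E s ⊆ E t) ∧
      N ⊆ ⋃ s, E s := by
  obtain ⟨C, hC, hsum, hfreq⟩ := exists_isClopen_tsum_ne_top_frequently_mem
    isTopologicalBasis_isClopen μ hN
  refine ⟨fun s => eventuallyMeets C s.1, fun s => ?_, fun s t hst => ?_, fun x hx => ?_⟩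
  · exact exists_isClosed_null_eventuallyMeets_subset μ (fun n => (hC n).isClosed) hsum s.2.1
  · exact eventuallyMeets_subset C s.2.1 t.2.1 hst
  · obtain ⟨s, hs, hmeet⟩ := exists_strictMono_forall_exists_mem_block (hfreq x hx)
    exact Set.mem_iUnion.2 ⟨⟨s, hs⟩, Eventually.of_forall hmeet⟩
end

section
/- Work in the Cantor space 2^ω = ℕ → ZMod 2 with its natural metric and its Haar probability measure μ. Assume GP(all) on 2^ω: for every family (A_x)_{x ∈ ℕ → ℕ} of μ-null subsets of 2^ω such that x ≤ x' pointwise implies A_x ⊆ A_{x'}, the union ⋃_{x ∈ ℕ → ℕ} A_x is μ-null. Then every strong measure zero set is null-additive: if X ⊆ 2^ω has strong measure zero, then for every μ-null set N ⊆ 2^ω the algebraic sum X + N = { x + y : x ∈ X, y ∈ N } is μ-null. -/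
open MeasureTheory Filter
open scoped Pointwise

/-- The standard metric on the Cantor space, `d(x,y) = 2^{-min{n : x n ≠ y n}}`,
compatible with the product topology. -/
noncomputable instance : MetricSpace Cantor := PiNat.metricSpace

/-- A compact null set has small neighbourhoods uniformly: some cylinder around `0` can be added
to it while keeping the measure below any given bound. -/
theorem Cantor.exists_measure_cylinder_add_le
    (μ : Measure Cantor) [IsProbabilityMeasure μ] {F : Set Cantor} (hF : IsCompact F)
    (hF0 : μ F = 0) {δ : ENNReal} (hδ : 0 < δ) :
    ∃ n : ℕ, μ (PiNat.cylinder 0 n + F) ≤ δ := by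
  obtain ⟨U, hFU, hU, hUδ⟩ := F.exists_isOpen_lt_of_lt δ (hF0 ▸ hδ)
  obtain ⟨V, hV, hVU⟩ := compact_open_separated_add_left hF hU hFU
  obtain ⟨r, hr, hrV⟩ := Metric.mem_nhds_iff.1 hV
  obtain ⟨n, hn⟩ := exists_pow_lt_of_lt_one hr (by norm_num : (1 / 2 : ℝ) < 1)
  refine ⟨n, (measure_mono ((Set.add_subset_add_right fun x hx => hrV ?_).trans hVU)).trans hUδ.le⟩
  exact Metric.mem_ball.2 ((PiNat.mem_cylinder_iff_dist_le.1 hx).trans_lt hn)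

/-- The sum of a strong measure zero set and a compact null set is null. -/
theorem Cantor.measure_add_eq_zero_of_isCompact
    (μ : Measure Cantor) [μ.IsAddHaarMeasure] [IsProbabilityMeasure μ]
    {X : Set Cantor}
    (hX : ∀ ε : ℕ → ℝ, (∀ n, 0 < ε n) →
      ∃ D : ℕ → Set Cantor, (∀ n, Metric.diam (D n) ≤ ε n) ∧ X ⊆ ⋃ n, D n)
    {F : Set Cantor} (hF : IsCompact F) (hF0 : μ F = 0) :
    μ (X + F) = 0 := by
  refine le_antisymm (ENNReal.le_of_forall_pos_le_add fun δ hδ _ => ?_) bot_le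
  obtain ⟨ε, hε, hεδ⟩ := ENNReal.exists_pos_sum_of_countable
    (ENNReal.coe_pos.2 hδ).ne' ℕ
  choose m hm using fun k => Cantor.exists_measure_cylinder_add_le μ hF hF0
    (ENNReal.coe_pos.2 (hε k))
  obtain ⟨D, hD, hXD⟩ := hX (fun k => (1 / 2) ^ m k) fun k => by positivity
  have hDF : ∀ k, μ (D k + F) ≤ ε k := fun k => by
    rcases (D k).eq_empty_or_nonempty with h | ⟨a, ha⟩
    · simp [h]
    have hsub : D k + F ⊆ a +ᵥ (PiNat.cylinder 0 (m k) + F) := by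
      rintro _ ⟨x, hx, z, hz, rfl⟩
      refine ⟨(x - a) + z, Set.add_mem_add ?_ hz, by simp only [vadd_eq_add]; abel⟩
      have hxa : x ∈ PiNat.cylinder a (m k) := PiNat.mem_cylinder_iff_dist_le.2
        ((Metric.dist_le_diam_of_mem (Metric.isBounded_of_compactSpace) hx ha).trans (hD k))
      exact fun i hi => by simp [hxa i hi]
    calc μ (D k + F) ≤ μ (a +ᵥ (PiNat.cylinder 0 (m k) + F)) := measure_mono hsub
      _ = μ (PiNat.cylinder 0 (m k) + F) := measure_vadd μ a _
      _ ≤ ε k := hm k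
  calc μ (X + F) ≤ μ (⋃ k, D k + F) := by
        rw [← Set.iUnion_add]
        exact measure_mono (Set.add_subset_add_right hXD)
    _ ≤ ∑' k, μ (D k + F) := measure_iUnion_le _
    _ ≤ ∑' k, (ε k : ENNReal) := ENNReal.tsum_le_tsum hDF
    _ ≤ 0 + δ := by simpa using hεδ.le

/-- **GP(all) implies SN = NA**: if every monotone family of `μ`-null subsets of the
Cantor group indexed by Baire space has `μ`-null union, then every strong measure zero
set `X` is null-additive: `X + N` is `μ`-null for every `μ`-null `N`. -/
theorem gp_all_implies_smz_null_additive
    (μ : Measure Cantor) [μ.IsAddHaarMeasure] [IsProbabilityMeasure μ]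
    (hGP : ∀ A : (ℕ → ℕ) → Set Cantor,
      (∀ x, μ (A x) = 0) →
      (∀ x x' : ℕ → ℕ, (∀ n, x n ≤ x' n) → A x ⊆ A x') →
      μ (⋃ x : ℕ → ℕ, A x) = 0)
    (X : Set Cantor)
    (hX : ∀ ε : ℕ → ℝ, (∀ n, 0 < ε n) →
      ∃ D : ℕ → Set Cantor, (∀ n, Metric.diam (D n) ≤ ε n) ∧ X ⊆ ⋃ n, D n)
    (N : Set Cantor) (hN : μ N = 0) :
    μ (X + N) = 0 := by
  choose U hNU hU hUn using fun n : ℕ => N.exists_isOpen_lt_of_lt (μ := μ) ((n : ENNReal) + 1)⁻¹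
    (by rw [hN]; exact ENNReal.inv_pos.2 (by finiteness))
  choose K hKc _ hKU hKm using fun n => (hU n).exists_iUnion_isClosed
  have hnull : ∀ x : ℕ → ℕ, μ (⋂ n, K n (x n)) = 0 := fun x => by
    refine le_antisymm (le_of_tendsto_of_tendsto' tendsto_const_nhds
      ((tendsto_add_atTop_iff_nat 1).2 ENNReal.tendsto_inv_nat_nhds_zero) fun n => ?_) bot_le
    push_cast
    refine (measure_mono ((Set.iInter_subset _ n).trans ?_)).trans (hUn n).le
    exact (Set.subset_iUnion (K n) (x n)).trans (hKU n).subset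
  refine measure_mono_null ?_ (hGP (fun x => X + ⋂ n, K n (x n))
    (fun x => Cantor.measure_add_eq_zero_of_isCompact μ hX
      (isClosed_iInter fun n => hKc n (x n)).isCompact (hnull x))
    fun x x' h => Set.add_subset_add_left (Set.iInter_mono fun n => hKm n (h n)))
  rintro _ ⟨a, ha, z, hz, rfl⟩
  have hzK : ∀ n, ∃ k, z ∈ K n k := fun n => by
    simpa using (hKU n).superset (hNU n hz)
  choose x hx using hzK
  exact Set.mem_iUnion.2 ⟨x, Set.add_mem_add ha (Set.mem_iInter.2 hx)⟩
end
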